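/- arXiv:1903.12526 — 3 statements merged into one kernel-verified Lean document; each statement's English description precedes it below -/
import Mathlib

section
/- For all integers g ≥ 0 and B ≥ 1 with 2−2g−B < 0 (B ≥ 2 if g = 0), the multi-boundary function G_g(z₁|…|z_B): (1) is, for each fixed i and fixed nonzero values of the other variables, a holomorphic function of z_i on ℂ∖{0}; (2) is an odd function of each variable: replacing any single z_i by −z_i changes the value by an overall sign, G_g(z₁|…|−z_i|…|z_B) = −G_g(z₁|…|z_i|…|z_B) for all nonzero z₁,…,z_B. -/
open scoped BigOperators
open MeasureTheory

noncomputable section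

namespace NCQFT

/-! ### Measure data: the planar 1‑point function `G0fun`, the moments and the operator `K̂`. -/

/-- The planar one-point function `𝒢₀(z) = s·z − n̄ + ½∫ᵃᵇ r(y)/((z+y)y) dy`. -/
def G0fun (a b s nbar : ℝ) (r : ℝ → ℝ) (z : ℂ) : ℂ :=
  (s : ℂ) * z - (nbar : ℂ) + (1 / 2) * ∫ y in a..b, (r y : ℂ) / ((z + (y : ℂ)) * (y : ℂ))

/-- Moments `ϱ_l = s·δ_{l,0} − ½∫ᵃᵇ r(y)/y^{3+2l} dy` of the measure. -/
def moment (a b s : ℝ) (r : ℝ → ℝ) (l : ℕ) : ℝ :=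
  (if l = 0 then s else 0) - (1 / 2) * ∫ y in a..b, r y / y ^ (3 + 2 * l)

/-- The integral operator `K̂`. -/
def Khat (a b s nbar : ℝ) (r : ℝ → ℝ) (f : ℂ → ℂ) (z : ℂ) : ℂ :=
  G0fun a b s nbar r z * f z + (nbar : ℂ) * f z
    + (1 / 2) * ∫ y in a..b, (r y : ℂ) * (f z - f (y : ℂ)) / (z ^ 2 - (y : ℂ) ^ 2)

/-- Admissible points: `z ∉ [a,b] ∪ (−[a,b]) ∪ {0}`. -/
def Admissible (a b : ℝ) (z : ℂ) : Prop :=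
  z ≠ 0 ∧ ∀ y : ℝ, y ∈ Set.Icc a b → z ≠ (y : ℂ) ∧ z ≠ -(y : ℂ)

/-! ### Partial Bell polynomials and the polynomials `S_m(ϱ)`. -/

/-- Partial Bell polynomial `B_{n,k}(x₁,…,x_{n−k+1})`. -/
def bellP (n k : ℕ) (x : ℕ → ℝ) : ℝ :=
  ∑ j : Fin n → Fin (n + 1),
    if (∑ i : Fin n, (j i : ℕ)) = k ∧ (∑ i : Fin n, ((i : ℕ) + 1) * (j i : ℕ)) = n then
      (n.factorial : ℝ) / (∏ i : Fin n, ((j i : ℕ).factorial : ℝ)) *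
        ∏ i : Fin n, (x ((i : ℕ) + 1) / (((i : ℕ) + 1).factorial : ℝ)) ^ (j i : ℕ)
    else 0

/-- `S_m(ϱ) = Σ_{i=0}^m (−1)^i i! ϱ₀^{−i} B_{m,i}(1!ϱ₁,…,(m−i+1)!ϱ_{m−i+1})`. -/
def Sm (ρ : ℕ → ℝ) (m : ℕ) : ℝ :=
  ∑ i ∈ Finset.range (m + 1),
    (-1) ^ i * (i.factorial : ℝ) * ((ρ 0)⁻¹) ^ i *
      bellP m i (fun j => (j.factorial : ℝ) * ρ j)

/-! ### Partial derivatives in the moment variables. -/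

/-- Partial derivative `∂/∂ϱ_l` of a real-valued function of the moments. -/
def pdR (c : (ℕ → ℝ) → ℝ) (l : ℕ) (ρ : ℕ → ℝ) : ℝ :=
  deriv (fun t => c (Function.update ρ l t)) (ρ l)

/-- Partial derivative `∂/∂ϱ_l` of a complex-valued function of the moments. -/
def pdC (c : (ℕ → ℝ) → ℂ) (l : ℕ) (ρ : ℕ → ℝ) : ℂ :=
  deriv (fun t : ℝ => c (Function.update ρ l t)) (ρ l)

/-! ### Boundary creation operators. -/

/-- Boundary creation operator `Â†_{z_J,w}` with free creation variable `w`, acting on a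
family `F` of the moments `ϱ` and boundary variables `(z_i)_{i∈J}`. -/
def AdagFree (J : Finset ℕ) (F : (ℕ → ℝ) → (ℕ → ℂ) → ℂ)
    (ρ : ℕ → ℝ) (z : ℕ → ℂ) (w : ℂ) : ℂ :=
  (∑' l : ℕ, (-((3 + 2 * (l : ℂ)) * (ρ (l + 1) : ℂ)) / ((ρ 0 : ℂ) * w ^ 3)
      + (3 + 2 * (l : ℂ)) / w ^ (5 + 2 * l)) * pdC (fun σ => F σ z) l ρ)
  + ∑ i ∈ J, (1 / ((ρ 0 : ℂ) * w ^ 3 * z i)) *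
      deriv (fun v => F ρ (Function.update z i v)) (z i)

/-- Boundary creation operator creating a boundary at coordinate `p`. -/
def AdagVar (J : Finset ℕ) (p : ℕ) (F : (ℕ → ℝ) → (ℕ → ℂ) → ℂ) :
    (ℕ → ℝ) → (ℕ → ℂ) → ℂ :=
  fun ρ z => AdagFree J F ρ z (z p)

/-- Boundary creation operator `Â†_w` acting on scalar functions of the moments only. -/
def AdagScalar (F : (ℕ → ℝ) → ℝ) (ρ : ℕ → ℝ) (w : ℂ) : ℂ :=
  ∑' l : ℕ, (-((3 + 2 * (l : ℂ)) * (ρ (l + 1) : ℂ)) / ((ρ 0 : ℂ) * w ^ 3)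
      + (3 + 2 * (l : ℂ)) / w ^ (5 + 2 * l)) * (pdR F l ρ : ℂ)

/-! ### The genus recursion for the 1-boundary functions `𝒢_g(z) = Σ_k c_{g,k}(ϱ)/z^{2k+3}`. -/

/-- Coefficients `e_m(ϱ)` of the even bracket
`w²·(Σ_{h=1}^{g-1} G_h(w)G_{g−h}(w) + (2λ)²·G_{g−1}(w|w))`, expressed through the table
`prev` of the coefficients of the lower-genus one-boundary functions. -/
def eBr (lam : ℝ) (g : ℕ) (prev : ℕ → ℕ → (ℕ → ℝ) → ℝ) (m : ℕ) (ρ : ℕ → ℝ) : ℝ :=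
  (∑ h ∈ Finset.Icc 1 (g - 1), ∑ i ∈ Finset.range (m + 1), ∑ j ∈ Finset.range (m + 1),
      if i + j + 2 = m then prev h i ρ * prev (g - h) j ρ else 0)
  + (2 * lam) ^ 4 *
    ((if 2 ≤ m then
        -(1 / ρ 0) * ∑' l : ℕ, (3 + 2 * (l : ℝ)) * ρ (l + 1) * pdR (prev (g - 1) (m - 2)) l ρ
      else 0)
    + (∑ k ∈ Finset.range (m + 1), ∑ l ∈ Finset.range (m + 1),
        if k + l + 3 = m then (3 + 2 * (l : ℝ)) * pdR (prev (g - 1) k) l ρ else 0)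
    + (if 3 ≤ m then -(((2 * (m - 3) + 3 : ℕ) : ℝ) * prev (g - 1) (m - 3) ρ) / ρ 0 else 0))

/-- Table of the coefficients of the one-boundary functions for all genera `h ≤ G`.
`Gtab lam G h k ρ` is the coefficient of `z^{-(2k+3)}` in `𝒢_h(z)`. -/
def Gtab (lam : ℝ) : ℕ → ℕ → ℕ → (ℕ → ℝ) → ℝ
  | 0 => fun _ _ _ => 0
  | 1 => fun h k ρ =>
      if h = 1 then
        (if k = 0 then 2 * lam ^ 4 * ρ 1 / (ρ 0) ^ 2
         else if k = 1 then -(2 * lam ^ 4) / ρ 0 else 0)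
      else 0
  | (G + 2) => fun h k ρ =>
      if h ≤ G + 1 then Gtab lam (G + 1) h k ρ
      else if h = G + 2 then
        -(1 / (2 * ρ 0)) *
          ∑' j : ℕ, eBr lam (G + 2) (Gtab lam (G + 1)) (k + j) ρ * Sm ρ j / (j.factorial : ℝ)
      else 0

/-- Coefficients of the genus-`g` one-boundary function. -/
def Gcoef (lam : ℝ) (g : ℕ) : ℕ → (ℕ → ℝ) → ℝ := Gtab lam g g

/-- One-boundary function `𝒢_g(z)` of genus `g ≥ 1`. -/
def Gfun (lam : ℝ) (g : ℕ) (ρ : ℕ → ℝ) (z : ℂ) : ℂ :=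
  ∑' k : ℕ, (Gcoef lam g k ρ : ℂ) / z ^ (2 * k + 3)

/-- The same-point two-boundary function `𝒢_g(z|z)`, with
`𝒢₀(z|z) := λ²/z⁴` and `𝒢_g(z|z) := (2λ)²(Â†_z + (1/(ϱ₀z⁴))∂_z)𝒢_g(z)` for `g ≥ 1`. -/
def Gpair (lam : ℝ) (g : ℕ) (ρ : ℕ → ℝ) (z : ℂ) : ℂ :=
  if g = 0 then (lam : ℂ) ^ 2 / z ^ 4
  else (2 * (lam : ℂ)) ^ 2 *
    ((∑' l : ℕ, (-((3 + 2 * (l : ℂ)) * (ρ (l + 1) : ℂ)) / ((ρ 0 : ℂ) * z ^ 3)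
        + (3 + 2 * (l : ℂ)) / z ^ (5 + 2 * l)) * pdC (fun σ => Gfun lam g σ z) l ρ)
     + (1 / ((ρ 0 : ℂ) * z ^ 4)) * deriv (Gfun lam g ρ) z)

/-! ### Multi-boundary functions. -/

/-- Iterated boundary creation for `g ≥ 1` (without prefactors); coordinates `0,…,B−1`. -/
def GBraw (lam : ℝ) (g : ℕ) : ℕ → (ℕ → ℝ) → (ℕ → ℂ) → ℂ
  | 0 => fun _ _ => 0
  | 1 => fun ρ z => Gfun lam g ρ (z 0)
  | (B + 2) => AdagVar (Finset.range (B + 1)) (B + 1) (GBraw lam g (B + 1))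

/-- Iterated boundary creation for `g = 0` (without prefactors), starting from `𝒢₀(z₁|z₂)`. -/
def GBraw0 (lam : ℝ) : ℕ → (ℕ → ℝ) → (ℕ → ℂ) → ℂ
  | 0 => fun _ _ => 0
  | 1 => fun _ _ => 0
  | 2 => fun _ z => 4 * (lam : ℂ) ^ 2 / (z 0 * z 1 * (z 0 + z 1) ^ 2)
  | (B + 3) => AdagVar (Finset.range (B + 2)) (B + 2) (GBraw0 lam (B + 2))

/-- The multi-boundary functions `𝒢_g(z₁|…|z_B)`, with variables at coordinates `0,…,B−1`:
`𝒢_g(z₁|…|z_B) = (2λ)^{3B−4} Â†_{(z₁..z_{B−1}),z_B}(⋯ Â†_{(z₁),z₂}𝒢_g(z₁)⋯)` for `g ≥ 1`,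
and `𝒢₀(z₁|…|z_B) = (2λ)^{3B−6} Â†(⋯ Â†𝒢₀(z₁|z₂)⋯)` for `g = 0`. -/
def GBfun (lam : ℝ) (g B : ℕ) (ρ : ℕ → ℝ) (z : ℕ → ℂ) : ℂ :=
  if g = 0 then (2 * (lam : ℂ)) ^ (3 * B - 6) * GBraw0 lam B ρ z
  else if B = 1 then Gfun lam g ρ (z 0)
  else (2 * (lam : ℂ)) ^ (3 * B - 4) * GBraw lam g B ρ z

/-! ### Free energies and boundary annihilation. -/

/-- Boundary annihilation applied to `𝒢_g`:  `Â_ǎ 𝒢_g = −Σ_l ϱ_l/(3+2l) · c_{g,l+1}(ϱ)`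
(the coefficient of `z^{−5−2l}` in `𝒢_g(z)` is `c_{g,l+1}`). -/
def AcheckG (lam : ℝ) (g : ℕ) (ρ : ℕ → ℝ) : ℝ :=
  -∑' l : ℕ, ρ l / (3 + 2 * (l : ℝ)) * Gcoef lam g (l + 1) ρ

/-- Free energies: `F₁ = −(1/24)·log ϱ₀`, and
`F_g = (1/((2g−2)(2λ)⁴))·Â_ǎ(𝒢_g)` for `g ≥ 2`. -/
def Ffree (lam : ℝ) (g : ℕ) (ρ : ℕ → ℝ) : ℝ :=
  if g = 1 then -(1 / 24) * Real.log (ρ 0)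
  else 1 / ((2 * (g : ℝ) - 2) * (2 * lam) ^ 4) * AcheckG lam g ρ

/-! ### Auxiliary notions. -/

/-- Variable assignment `(z₁, z_{i₁}, z_{i₂}, …)` with first slot `w` and the remaining slots
filled by the coordinates of `z` indexed by the set `I` in increasing order. -/
def slotAt (z : ℕ → ℂ) (w : ℂ) (I : Finset ℕ) : ℕ → ℂ :=
  fun n => if n = 0 then w else z ((I.sort (· ≤ ·)).getD (n - 1) 0)

/-- A polynomial in variables `x₁,…,x_j` is `j`-weighted if each of its monomials
`∏ x_i^{m_i}` satisfies `Σ i·m_i = j`. -/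
def IsWeighted (j : ℕ) (P : MvPolynomial (Fin j) ℚ) : Prop :=
  ∀ m ∈ P.support, (∑ i : Fin j, ((i : ℕ) + 1) * m i) = j

/-- A smooth family `F(ϱ₀,…,ϱ_M; (z_i)_{i∈J})`: it factors through a function of the first
`M+1` moments and the coordinates in `J` which is smooth (and holomorphic in each `z_i`)
on the region `ϱ₀ ≠ 0`, `z_i ≠ 0`. -/
def SmoothFam (M : ℕ) (J : Finset ℕ) (F : (ℕ → ℝ) → (ℕ → ℂ) → ℂ) : Prop :=
  ∃ Ft : ((Fin (M + 1) → ℝ) × ({ i // i ∈ J } → ℂ)) → ℂ,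
    ContDiffOn ℝ (⊤ : ℕ∞) Ft { x | x.1 0 ≠ 0 ∧ ∀ i, x.2 i ≠ 0 } ∧
    (∀ x ∈ ({ x : (Fin (M + 1) → ℝ) × ({ i // i ∈ J } → ℂ) |
        x.1 0 ≠ 0 ∧ ∀ i, x.2 i ≠ 0 }), ∀ i,
      DifferentiableAt ℂ (fun w => Ft (x.1, Function.update x.2 i w)) (x.2 i)) ∧
    ∀ ρ z, F ρ z = Ft (fun l => ρ (l : ℕ), fun i => z (i : ℕ))

/-- A smooth scalar function of `ϱ₀ ≠ 0, ϱ₁, …, ϱ_M`. -/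
def SmoothScalarFam (M : ℕ) (F : (ℕ → ℝ) → ℝ) : Prop :=
  ∃ Ft : (Fin (M + 1) → ℝ) → ℝ,
    ContDiffOn ℝ (⊤ : ℕ∞) Ft { v | v 0 ≠ 0 } ∧ ∀ ρ : ℕ → ℝ, F ρ = Ft (fun l => ρ (l : ℕ))

/-! ### The Laplacian of Theorem `Δ_ϱ`. -/

/-- `R_m(ϱ) = −(2/3) Σ_{k=1}^m (kϱ_k/((3+2k)ϱ₀))·S_{m−k}(ϱ)/(m−k)!`. -/
def Rm (ρ : ℕ → ℝ) (m : ℕ) : ℝ :=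
  -(2 / 3) * ∑ k ∈ Finset.Icc 1 m,
    ((k : ℝ) * ρ k / ((3 + 2 * (k : ℝ)) * ρ 0)) * (Sm ρ (m - k) / ((m - k).factorial : ℝ))

/-- The Laplacian `Δ_ϱ`, acting on functions of the moments. -/
def DeltaRho (F : (ℕ → ℝ) → ℝ) (ρ : ℕ → ℝ) : ℝ :=
  -(-(6 * ρ 1 ^ 3) / (5 * ρ 0 ^ 3) + 111 * ρ 1 * ρ 2 / (70 * ρ 0 ^ 2)
      - ρ 3 / (2 * ρ 0)) * pdR (fun σ => pdR F 0 σ) 0 ρ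
  - (2 * ρ 1 ^ 3 / ρ 0 ^ 4 - 1097 * ρ 1 * ρ 2 / (280 * ρ 0 ^ 3)
      + 41 * ρ 3 / (24 * ρ 0 ^ 2)) * pdR F 0 ρ
  - (∑' k : ℕ, (3 + 2 * ((k : ℝ) + 1)) *
      ((-(2 * ρ 1 ^ 2 / (5 * ρ 0 ^ 3)) + 2 * ρ 2 / (7 * ρ 0 ^ 2)) * ρ (k + 2)
        - 3 * Rm ρ (k + 3) * ρ 1 / (2 * ρ 0) + 3 * Rm ρ (k + 4) / 2) *
      pdR (fun σ => pdR F 0 σ) (k + 1) ρ)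
  - (∑' k : ℕ, ∑' l : ℕ, (3 + 2 * ((k : ℝ) + 1)) * (3 + 2 * ((l : ℝ) + 1)) *
      (-(ρ 1 * ρ (l + 2) * ρ (k + 2) / (30 * ρ 0 ^ 2))
        - ρ (k + 2) * Rm ρ (l + 3) / (4 * ρ 0)
        - ρ (l + 2) * Rm ρ (k + 3) / (4 * ρ 0)
        + Rm ρ (k + l + 5) / 4) *
      pdR (fun σ => pdR F (l + 1) σ) (k + 1) ρ)
  - (∑' k : ℕ, (3 + 2 * ((k : ℝ) + 1)) *
      ((19 * ρ 1 ^ 2 / (60 * ρ 0 ^ 4) - 25 * ρ 2 / (84 * ρ 0 ^ 3)) * ρ (k + 2)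
        + ρ 1 * Rm ρ (k + 3) / (16 * ρ 0 ^ 2)
        - Rm ρ (k + 4) / (16 * ρ 0)
        - (5 + 2 * ((k : ℝ) + 1)) * ρ 1 * ρ (k + 3) / (30 * ρ 0 ^ 3)
        - (5 + 2 * ((k : ℝ) + 1)) * Rm ρ (k + 4) / (2 * ρ 0)) *
      pdR F (k + 1) ρ)

/-- The operator `D = −(2λ)⁴Δ_ϱ + (2λ)⁴·(−21ϱ₁³/(160ϱ₀⁵)+29ϱ₁ϱ₂/(128ϱ₀⁴)−35ϱ₃/(384ϱ₀³))·`. -/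
def Dop (lam : ℝ) (F : (ℕ → ℝ) → ℝ) : (ℕ → ℝ) → ℝ :=
  fun ρ => -(2 * lam) ^ 4 * DeltaRho F ρ
    + (2 * lam) ^ 4 * (-(21 / 160) * ρ 1 ^ 3 / ρ 0 ^ 5 + (29 / 128) * ρ 1 * ρ 2 / ρ 0 ^ 4
        - (35 / 384) * ρ 3 / ρ 0 ^ 3) * F ρ

end NCQFT

namespace NCQFT

/-- Rational functions of the moments with denominators powers of `ϱ₀`. -/
inductive IsRat : ((ℕ → ℝ) → ℝ) → Prop
  | const (a : ℝ) : IsRat (fun _ => a)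
  | var (l : ℕ) : IsRat (fun ρ => ρ l)
  | inv : IsRat (fun ρ => (ρ 0)⁻¹)
  | add {c d} : IsRat c → IsRat d → IsRat (fun ρ => c ρ + d ρ)
  | mul {c d} : IsRat c → IsRat d → IsRat (fun ρ => c ρ * d ρ)
  | congr {c d} : IsRat c → (∀ ρ : ℕ → ℝ, ρ 0 ≠ 0 → d ρ = c ρ) → IsRat d

lemma update_zero_ev (ρ : ℕ → ℝ) (h : ρ 0 ≠ 0) (l : ℕ) :
    ∀ᶠ t in nhds (ρ l), Function.update ρ l t 0 ≠ 0 := by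
  by_cases hl : l = 0
  · subst hl
    simp only [Function.update_self]
    exact isOpen_ne.mem_nhds h
  · exact Filter.Eventually.of_forall fun t => by
      rw [Function.update_of_ne (Ne.symm hl)]; exact h

lemma IsRat.diff {c} (hc : IsRat c) (ρ : ℕ → ℝ) (h : ρ 0 ≠ 0) (l : ℕ) :
    DifferentiableAt ℝ (fun t => c (Function.update ρ l t)) (ρ l) := by
  induction hc with
  | const a => simp
  | var m =>
    by_cases hm : m = l
    · subst hm; simp
    · simp [Function.update_of_ne hm]
  | inv =>
    by_cases hm : 0 = l
    · subst hm; simpa using differentiableAt_inv h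
    · simp [Function.update_of_ne hm]
  | add _ _ h1 h2 => exact h1.add h2
  | mul _ _ h1 h2 => exact h1.mul h2
  | congr _ hcd h1 =>
    refine h1.congr_of_eventuallyEq ?_
    filter_upwards [update_zero_ev ρ h l] with t ht using hcd _ ht

lemma pdR_congr {c d : (ℕ → ℝ) → ℝ} (hcd : ∀ ρ : ℕ → ℝ, ρ 0 ≠ 0 → d ρ = c ρ)
    (ρ : ℕ → ℝ) (h : ρ 0 ≠ 0) (l : ℕ) : pdR d l ρ = pdR c l ρ := by
  unfold pdR
  refine Filter.EventuallyEq.deriv_eq ?_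
  filter_upwards [update_zero_ev ρ h l] with t ht using hcd _ ht

lemma pdR_const (a : ℝ) (l : ℕ) (ρ : ℕ → ℝ) : pdR (fun _ => a) l ρ = 0 := by
  simp [pdR]

lemma pdR_var (m l : ℕ) (ρ : ℕ → ℝ) :
    pdR (fun ρ => ρ m) l ρ = if m = l then 1 else 0 := by
  unfold pdR
  by_cases hm : m = l
  · subst hm; simp
  · simp [Function.update_of_ne hm, hm]

lemma pdR_inv (l : ℕ) (ρ : ℕ → ℝ) :
    pdR (fun ρ => (ρ 0)⁻¹) l ρ = if 0 = l then -((ρ 0)⁻¹ * (ρ 0)⁻¹) else 0 := by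
  unfold pdR
  by_cases hm : 0 = l
  · subst hm; simp [sq]
  · simp [Function.update_of_ne hm, hm]

lemma pdR_add {c d} (hc : IsRat c) (hd : IsRat d) (l : ℕ) (ρ : ℕ → ℝ) (h : ρ 0 ≠ 0) :
    pdR (fun ρ => c ρ + d ρ) l ρ = pdR c l ρ + pdR d l ρ :=
  deriv_fun_add (hc.diff ρ h l) (hd.diff ρ h l)

lemma pdR_mul {c d} (hc : IsRat c) (hd : IsRat d) (l : ℕ) (ρ : ℕ → ℝ) (h : ρ 0 ≠ 0) :
    pdR (fun ρ => c ρ * d ρ) l ρ = pdR c l ρ * d ρ + c ρ * pdR d l ρ := by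
  have := deriv_fun_mul (hc.diff ρ h l) (hd.diff ρ h l)
  simpa [pdR] using this

lemma IsRat.pd {c} (hc : IsRat c) (l : ℕ) : IsRat (pdR c l) := by
  induction hc with
  | const a => exact (IsRat.const 0).congr fun ρ _ => pdR_const a l ρ
  | var m =>
    exact (IsRat.const (if m = l then 1 else 0)).congr fun ρ _ => pdR_var m l ρ
  | inv =>
    refine (((IsRat.const (if 0 = l then -1 else 0)).mul (IsRat.inv.mul IsRat.inv))).congr
      fun ρ _ => ?_
    rw [pdR_inv]; split_ifs <;> simp
  | add h1 h2 i1 i2 => exact (i1.add i2).congr fun ρ h => pdR_add h1 h2 l ρ h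
  | mul h1 h2 i1 i2 =>
    exact ((i1.mul h2).add (h1.mul i2)).congr fun ρ h => pdR_mul h1 h2 l ρ h
  | congr _ hcd h1 => exact h1.congr fun ρ h => pdR_congr hcd ρ h l

lemma IsRat.fin {c} (hc : IsRat c) :
    ∃ M, ∀ l, M ≤ l → ∀ ρ : ℕ → ℝ, ρ 0 ≠ 0 → pdR c l ρ = 0 := by
  induction hc with
  | const a => exact ⟨0, fun l _ ρ _ => pdR_const a l ρ⟩
  | var m => exact ⟨m + 1, fun l hl ρ _ => by rw [pdR_var, if_neg (by omega)]⟩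
  | inv => exact ⟨1, fun l hl ρ _ => by rw [pdR_inv, if_neg (by omega)]⟩
  | add h1 h2 i1 i2 =>
    obtain ⟨M, hM⟩ := i1
    obtain ⟨N, hN⟩ := i2
    refine ⟨M + N, fun l hl ρ h => ?_⟩
    rw [pdR_add h1 h2 l ρ h, hM l (by omega) ρ h, hN l (by omega) ρ h, add_zero]
  | mul h1 h2 i1 i2 =>
    obtain ⟨M, hM⟩ := i1
    obtain ⟨N, hN⟩ := i2
    refine ⟨M + N, fun l hl ρ h => ?_⟩
    rw [pdR_mul h1 h2 l ρ h, hM l (by omega) ρ h, hN l (by omega) ρ h]; simp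
  | congr _ hcd h1 =>
    obtain ⟨M, hM⟩ := h1
    exact ⟨M, fun l hl ρ h => by rw [pdR_congr hcd ρ h, hM l hl ρ h]⟩

lemma IsRat.sum {ι : Type*} (s : Finset ι) (f : ι → (ℕ → ℝ) → ℝ)
    (hf : ∀ i ∈ s, IsRat (f i)) : IsRat (fun ρ => ∑ i ∈ s, f i ρ) := by
  classical
  induction s using Finset.induction_on with
  | empty => simpa using IsRat.const 0
  | insert a s ha ih =>
    simp only [Finset.sum_insert ha]
    exact (hf a (by simp)).add (ih fun i hi => hf i (by simp [hi]))

lemma IsRat.pow {c} (hc : IsRat c) (n : ℕ) : IsRat (fun ρ => c ρ ^ n) := by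
  induction n with
  | zero => simpa using IsRat.const 1
  | succ n ih => simp only [pow_succ]; exact ih.mul hc

lemma IsRat.prod {ι : Type*} (s : Finset ι) (f : ι → (ℕ → ℝ) → ℝ)
    (hf : ∀ i ∈ s, IsRat (f i)) : IsRat (fun ρ => ∏ i ∈ s, f i ρ) := by
  classical
  induction s using Finset.induction_on with
  | empty => simpa using IsRat.const 1
  | insert a s ha ih =>
    simp only [Finset.prod_insert ha]
    exact (hf a (by simp)).mul (ih fun i hi => hf i (by simp [hi]))

lemma IsRat.divc {c} (hc : IsRat c) (a : ℝ) : IsRat (fun ρ => c ρ / a) := by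
  simp only [div_eq_mul_inv]; exact hc.mul (IsRat.const _)

lemma IsRat.ite {c d} (p : Prop) [Decidable p] (hc : p → IsRat c) (hd : ¬ p → IsRat d) :
    IsRat (fun ρ => if p then c ρ else d ρ) := by
  by_cases h : p
  · simpa [h] using hc h
  · simpa [h] using hd h

lemma IsRat.Sm (m : ℕ) : IsRat (fun ρ => Sm ρ m) := by
  unfold NCQFT.Sm bellP
  refine IsRat.sum _ _ fun i _ => ?_
  refine ((IsRat.const _).mul (IsRat.inv.pow i)).mul ?_
  refine IsRat.sum _ _ fun j _ => ?_
  refine IsRat.ite _ (fun _ => ?_) (fun _ => IsRat.const 0)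
  refine (IsRat.const _).mul ?_
  refine IsRat.prod _ _ fun t _ => ?_
  exact (((IsRat.const _).mul (IsRat.var _)).divc _).pow _

/-- Tables of rational coefficients with finitely many nonzero entries. -/
def GoodTab (P : ℕ → (ℕ → ℝ) → ℝ) : Prop :=
  (∀ k, IsRat (P k)) ∧ ∃ K, ∀ k, K ≤ k → ∀ ρ : ℕ → ℝ, ρ 0 ≠ 0 → P k ρ = 0

lemma pdR_zero_of {c : (ℕ → ℝ) → ℝ} (hc : ∀ ρ : ℕ → ℝ, ρ 0 ≠ 0 → c ρ = 0)
    (ρ : ℕ → ℝ) (h : ρ 0 ≠ 0) (l : ℕ) : pdR c l ρ = 0 := by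
  rw [pdR_congr (c := fun _ => 0) hc ρ h, pdR_const]

lemma IsRat.tsum (f : ℕ → (ℕ → ℝ) → ℝ) (hf : ∀ l, IsRat (f l)) (M : ℕ)
    (hM : ∀ l, M ≤ l → ∀ ρ : ℕ → ℝ, ρ 0 ≠ 0 → f l ρ = 0) :
    IsRat (fun ρ => ∑' l, f l ρ) := by
  refine (IsRat.sum (Finset.range M) f fun i _ => hf i).congr fun ρ h => ?_
  refine tsum_eq_sum fun l hl => hM l ?_ ρ h
  simpa using hl

lemma GoodTab.eBr (lam : ℝ) (g : ℕ) (prev : ℕ → ℕ → (ℕ → ℝ) → ℝ)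
    (hp : ∀ h, GoodTab (prev h)) : GoodTab (eBr lam g prev) := by
  refine ⟨fun m => ?_, ?_⟩
  · unfold NCQFT.eBr
    refine IsRat.add ?_ ((IsRat.const _).mul ((IsRat.add (IsRat.add ?_ ?_) ?_)))
    · refine IsRat.sum _ _ fun h _ => IsRat.sum _ _ fun i _ => IsRat.sum _ _ fun j _ => ?_
      exact IsRat.ite _ (fun _ => ((hp _).1 _).mul ((hp _).1 _)) (fun _ => IsRat.const 0)
    · refine IsRat.ite _ (fun _ => ?_) (fun _ => IsRat.const 0)
      obtain ⟨M, hM⟩ := ((hp (g - 1)).1 (m - 2)).fin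
      refine IsRat.mul (c := fun ρ => -(1 / ρ 0)) ?_ ?_
      · exact ((IsRat.const (-1)).mul IsRat.inv).congr fun ρ _ => by simp
      · refine IsRat.tsum (fun l ρ => (3 + 2 * (l : ℝ)) * ρ (l + 1) *
          pdR (prev (g - 1) (m - 2)) l ρ) (fun l => ?_) M ?_
        · exact ((IsRat.const _).mul (IsRat.var _)).mul (((hp _).1 _).pd l)
        · intro l hl ρ h
          simp [hM l hl ρ h]
    · refine IsRat.sum _ _ fun i _ => IsRat.sum _ _ fun j _ => ?_
      exact IsRat.ite _ (fun _ => (IsRat.const _).mul (((hp _).1 _).pd _))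
        (fun _ => IsRat.const 0)
    · refine IsRat.ite _ (fun _ => ?_) (fun _ => IsRat.const 0)
      exact (((IsRat.const (-((2 * (m - 3) + 3 : ℕ) : ℝ))).mul ((hp (g - 1)).1 (m - 3))).mul
        IsRat.inv).congr fun ρ _ => by rw [div_eq_mul_inv]; ring
  · choose K hK using fun h => (hp h).2
    choose M hM using fun k => ((hp (g - 1)).1 k).fin
    let KK := ∑ h ∈ Finset.range (g + 1), K h
    have hKK : ∀ h, h ≤ g → K h ≤ KK := fun h hh =>
      Finset.single_le_sum (f := K) (fun _ _ => Nat.zero_le _) (by simp; omega)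
    let MM := ∑ k ∈ Finset.range KK, M k
    have hMM : ∀ k, k < KK → M k ≤ MM := fun k hk =>
      Finset.single_le_sum (f := M) (fun _ _ => Nat.zero_le _) (by simp; omega)
    have hz : ∀ h, h ≤ g → ∀ k, KK ≤ k → ∀ ρ : ℕ → ℝ, ρ 0 ≠ 0 → prev h k ρ = 0 :=
      fun h hh k hk ρ h0 => hK h k ((hKK h hh).trans hk) ρ h0
    refine ⟨2 * KK + MM + 3, fun m hm ρ h0 => ?_⟩
    unfold NCQFT.eBr
    have h1 : (∑ h ∈ Finset.Icc 1 (g - 1), ∑ i ∈ Finset.range (m + 1),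
        ∑ j ∈ Finset.range (m + 1),
        if i + j + 2 = m then prev h i ρ * prev (g - h) j ρ else 0) = 0 := by
      refine Finset.sum_eq_zero fun h hh => Finset.sum_eq_zero fun i _ =>
        Finset.sum_eq_zero fun j _ => ?_
      rw [Finset.mem_Icc] at hh
      split_ifs with hij
      · by_cases hi : KK ≤ i
        · rw [hz h (by omega) i hi ρ h0, zero_mul]
        · rw [hz (g - h) (by omega) j (by omega) ρ h0, mul_zero]
      · rfl
    have h2 : (∑' l : ℕ, (3 + 2 * (l : ℝ)) * ρ (l + 1) *
        pdR (prev (g - 1) (m - 2)) l ρ) = 0 := by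
      have : ∀ l, pdR (prev (g - 1) (m - 2)) l ρ = 0 := fun l =>
        pdR_zero_of (hz (g - 1) (by omega) _ (by omega)) ρ h0 l
      simp [this]
    have h3 : (∑ k ∈ Finset.range (m + 1), ∑ l ∈ Finset.range (m + 1),
        if k + l + 3 = m then (3 + 2 * (l : ℝ)) * pdR (prev (g - 1) k) l ρ else 0) = 0 := by
      refine Finset.sum_eq_zero fun k _ => Finset.sum_eq_zero fun l _ => ?_
      split_ifs with hkl
      · by_cases hk : KK ≤ k
        · rw [pdR_zero_of (hz (g - 1) (by omega) k hk) ρ h0 l, mul_zero]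
        · have := hMM k (by omega)
          rw [hM k l (by omega) ρ h0, mul_zero]
      · rfl
    rw [h1, h2, h3, hz (g - 1) (by omega) (m - 3) (by omega) ρ h0]
    simp

lemma GoodTab.zero : GoodTab (fun _ _ => 0) :=
  ⟨fun _ => IsRat.const 0, 0, fun _ _ _ _ => rfl⟩

lemma GoodTab.Gtab (lam : ℝ) : ∀ G h, GoodTab (Gtab lam G h)
  | 0, h => GoodTab.zero
  | 1, h => by
    unfold NCQFT.Gtab
    by_cases hh : h = 1
    · simp only [hh, if_true]
      refine ⟨fun k => ?_, 2, fun k hk ρ _ => ?_⟩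
      · refine IsRat.ite _ (fun _ => ?_) fun _ => IsRat.ite _ (fun _ => ?_)
          fun _ => IsRat.const 0
        · exact (((IsRat.const (2 * lam ^ 4)).mul (IsRat.var 1)).mul (IsRat.inv.pow 2)).congr
            fun ρ _ => by simp [div_eq_mul_inv]
        · exact ((IsRat.const (-(2 * lam ^ 4))).mul IsRat.inv).congr
            fun ρ _ => by simp [div_eq_mul_inv]
      · beta_reduce
        rw [if_neg (by omega), if_neg (by omega)]
    · simp only [hh, if_false]; exact GoodTab.zero
  | (G + 2), h => by
    have ih := GoodTab.Gtab lam (G + 1)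
    unfold NCQFT.Gtab
    by_cases hh : h ≤ G + 1
    · simp only [hh, if_true]; exact ih h
    · by_cases hg : h = G + 2
      · simp only [hh, if_false, hg, if_true]
        simp only [show ¬ (G + 2 ≤ G + 1) by omega, if_false]
        obtain ⟨he, K, hK⟩ := GoodTab.eBr lam (G + 2) _ ih
        refine ⟨fun k => ?_, K, fun k hk ρ h0 => ?_⟩
        · refine IsRat.mul (c := fun ρ => -(1 / (2 * ρ 0))) ?_ ?_
          · exact ((IsRat.const (-(2⁻¹))).mul IsRat.inv).congr fun ρ _ => by
              simp [mul_comm]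
          · refine IsRat.tsum (fun j ρ => NCQFT.eBr lam (G + 2) (NCQFT.Gtab lam (G + 1))
              (k + j) ρ * NCQFT.Sm ρ j / (j.factorial : ℝ)) (fun j => ?_) K ?_
            · exact ((he _).mul (IsRat.Sm j)).divc _
            · intro j hj ρ h0
              simp [hK (k + j) (by omega) ρ h0]
        · have : ∀ j, NCQFT.eBr lam (G + 2) (NCQFT.Gtab lam (G + 1)) (k + j) ρ = 0 :=
            fun j => hK _ (by omega) ρ h0
          simp [this]
      · simp only [hh, hg, if_false]; exact GoodTab.zero

/-- Odd Laurent monomial. -/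
def mon (B : ℕ) (k : ℕ → ℕ) (z : ℕ → ℂ) : ℂ :=
  ∏ j ∈ Finset.range B, (z j)⁻¹ ^ (2 * k j + 1)

/-- Finite sums of odd Laurent monomials with rational coefficients. -/
inductive Nice (B : ℕ) : ((ℕ → ℝ) → (ℕ → ℂ) → ℂ) → Prop
  | zero : Nice B (fun _ _ => 0)
  | mono {c} (k : ℕ → ℕ) : IsRat c → Nice B (fun ρ z => (c ρ : ℂ) * mon B k z)
  | add {F H} : Nice B F → Nice B H → Nice B (fun ρ z => F ρ z + H ρ z)

lemma Nice.sum {B : ℕ} {ι : Type*} (s : Finset ι) (F : ι → (ℕ → ℝ) → (ℕ → ℂ) → ℂ)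
    (hF : ∀ i ∈ s, Nice B (F i)) : Nice B (fun ρ z => ∑ i ∈ s, F i ρ z) := by
  classical
  induction s using Finset.induction_on with
  | empty => simpa using Nice.zero
  | insert a s ha ih =>
    simp only [Finset.sum_insert ha]
    exact (hF a (by simp)).add (ih fun i hi => hF i (by simp [hi]))

lemma mon_update (B : ℕ) (k : ℕ → ℕ) (z : ℕ → ℂ) (i : ℕ) (hi : i < B) (v : ℂ) :
    mon B k (Function.update z i v) = v⁻¹ ^ (2 * k i + 1) *
      ∏ j ∈ (Finset.range B).erase i, (z j)⁻¹ ^ (2 * k j + 1) := by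
  unfold mon
  rw [← Finset.mul_prod_erase _ _ (Finset.mem_range.2 hi)]
  congr 1
  · simp
  · refine Finset.prod_congr rfl fun j hj => ?_
    rw [Function.update_of_ne (Finset.ne_of_mem_erase hj)]

lemma hasDeriv_mon (B : ℕ) (k : ℕ → ℕ) (z : ℕ → ℂ) (i : ℕ) (hi : i < B) (v : ℂ)
    (hv : v ≠ 0) :
    HasDerivAt (fun v => mon B k (Function.update z i v))
      (-((2 * k i + 1 : ℕ) : ℂ) * v⁻¹ * mon B k (Function.update z i v)) v := by
  simp only [mon_update B k z i hi]
  have h1 := ((hasDerivAt_inv hv).pow (2 * k i + 1)).mul_const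
    (∏ j ∈ (Finset.range B).erase i, (z j)⁻¹ ^ (2 * k j + 1))
  refine h1.congr_deriv ?_
  rw [Nat.add_sub_cancel, pow_succ v⁻¹ (2 * k i), ← inv_pow v 2]
  ring

lemma Nice.diffz {B F} (hF : Nice B F) (ρ : ℕ → ℝ) (z : ℕ → ℂ) (i : ℕ) (hi : i < B) (v : ℂ)
    (hv : v ≠ 0) : DifferentiableAt ℂ (fun v => F ρ (Function.update z i v)) v := by
  induction hF with
  | zero => simp
  | mono k hc => exact ((hasDeriv_mon B k z i hi v hv).differentiableAt).const_mul _
  | add _ _ h1 h2 => exact h1.add h2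

lemma Nice.odd {B F} (hF : Nice B F) (ρ : ℕ → ℝ) (z : ℕ → ℂ) (i : ℕ) (hi : i < B) :
    F ρ (Function.update z i (-(z i))) = -F ρ z := by
  induction hF with
  | zero => simp
  | mono k hc =>
    have h := mon_update B k z i hi (z i)
    rw [Function.update_eq_self] at h
    beta_reduce
    rw [mon_update B k z i hi, h, inv_neg, (Odd.neg_pow ⟨k i, rfl⟩ _)]
    ring
  | add _ _ h1 h2 => beta_reduce; rw [h1, h2]; ring

lemma hasDeriv_coef {c} (hc : IsRat c) (ρ : ℕ → ℝ) (h : ρ 0 ≠ 0) (l : ℕ) (m : ℂ) :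
    HasDerivAt (fun t : ℝ => (c (Function.update ρ l t) : ℂ) * m)
      ((pdR c l ρ : ℂ) * m) (ρ l) :=
  ((hc.diff ρ h l).hasDerivAt.ofReal_comp).mul_const m

lemma Nice.diffr {B F} (hF : Nice B F) (ρ : ℕ → ℝ) (h : ρ 0 ≠ 0) (z : ℕ → ℂ) (l : ℕ) :
    DifferentiableAt ℝ (fun t : ℝ => F (Function.update ρ l t) z) (ρ l) := by
  induction hF with
  | zero => simp
  | mono k hc => exact (hasDeriv_coef hc ρ h l _).differentiableAt
  | add _ _ h1 h2 => exact h1.add h2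

lemma pdC_add {B F H} (hF : Nice B F) (hH : Nice B H) (ρ : ℕ → ℝ) (h : ρ 0 ≠ 0)
    (z : ℕ → ℂ) (l : ℕ) :
    pdC (fun σ => F σ z + H σ z) l ρ = pdC (fun σ => F σ z) l ρ + pdC (fun σ => H σ z) l ρ :=
  deriv_fun_add (hF.diffr ρ h z l) (hH.diffr ρ h z l)

lemma Nice.fin {B F} (hF : Nice B F) :
    ∃ M, ∀ l, M ≤ l → ∀ ρ : ℕ → ℝ, ρ 0 ≠ 0 → ∀ z, pdC (fun σ => F σ z) l ρ = 0 := by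
  induction hF with
  | zero => exact ⟨0, fun l _ ρ _ z => by simp [pdC]⟩
  | mono k hc =>
    obtain ⟨M, hM⟩ := hc.fin
    refine ⟨M, fun l hl ρ h z => ?_⟩
    have := (hasDeriv_coef hc ρ h l (mon B k z)).deriv
    rw [hM l hl ρ h] at this
    simpa [pdC] using this
  | add h1 h2 i1 i2 =>
    obtain ⟨M, hM⟩ := i1
    obtain ⟨N, hN⟩ := i2
    refine ⟨M + N, fun l hl ρ h z => ?_⟩
    rw [pdC_add h1 h2 ρ h z l, hM l (by omega) ρ h z, hN l (by omega) ρ h z, add_zero]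

lemma mon_succ (B : ℕ) (k : ℕ → ℕ) (n : ℕ) (z : ℕ → ℂ) :
    mon (B + 1) (Function.update k B n) z = mon B k z * (z B)⁻¹ ^ (2 * n + 1) := by
  unfold mon
  rw [Finset.prod_range_succ]
  congr 1
  · refine Finset.prod_congr rfl fun j hj => ?_
    rw [Function.update_of_ne (by have := Finset.mem_range.1 hj; omega)]
  · simp

lemma mon_raise (B : ℕ) (k : ℕ → ℕ) (i : ℕ) (hi : i < B) (z : ℕ → ℂ) :
    mon B (Function.update k i (k i + 1)) z = mon B k z * (z i)⁻¹ ^ 2 := by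
  unfold mon
  rw [← Finset.mul_prod_erase _ _ (Finset.mem_range.2 hi),
    ← Finset.mul_prod_erase _ (fun j => (z j)⁻¹ ^ (2 * k j + 1)) (Finset.mem_range.2 hi)]
  have : ∏ j ∈ (Finset.range B).erase i, (z j)⁻¹ ^ (2 * Function.update k i (k i + 1) j + 1)
      = ∏ j ∈ (Finset.range B).erase i, (z j)⁻¹ ^ (2 * k j + 1) := by
    refine Finset.prod_congr rfl fun j hj => ?_
    rw [Function.update_of_ne (Finset.ne_of_mem_erase hj)]
  rw [this]
  simp only [Function.update_self]
  ring

lemma Nice.adag {B F} (hF : Nice B F) :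
    ∃ H, Nice (B + 1) H ∧ ∀ ρ : ℕ → ℝ, ρ 0 ≠ 0 → ∀ z : ℕ → ℂ, (∀ j < B, z j ≠ 0) →
      AdagVar (Finset.range B) B F ρ z = H ρ z := by
  induction hF with
  | zero =>
    exact ⟨_, Nice.zero, fun ρ h z hz => by simp [AdagVar, AdagFree, pdC]⟩
  | @mono c k hc =>
    obtain ⟨M, hM⟩ := hc.fin
    refine ⟨fun ρ z => (∑ l ∈ Finset.range M,
        ((((-(3 + 2 * (l : ℝ)) * ρ (l + 1) * (ρ 0)⁻¹ * pdR c l ρ : ℝ) : ℂ) *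
            mon (B + 1) (Function.update k B 1) z) +
          (((3 + 2 * (l : ℝ)) * pdR c l ρ : ℝ) : ℂ) *
            mon (B + 1) (Function.update k B (l + 2)) z)) +
        ∑ i ∈ Finset.range B, ((-((2 * k i + 1 : ℕ) : ℝ) * (ρ 0)⁻¹ * c ρ : ℝ) : ℂ) *
          mon (B + 1) (Function.update (Function.update k i (k i + 1)) B 1) z, ?_, ?_⟩
    · refine Nice.add (Nice.sum _ _ fun l _ => Nice.add ?_ ?_) (Nice.sum _ _ fun i _ => ?_)
      · exact Nice.mono (c := fun ρ => -(3 + 2 * (l : ℝ)) * ρ (l + 1) * (ρ 0)⁻¹ * pdR c l ρ) _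
          ((((IsRat.const _).mul (IsRat.var _)).mul IsRat.inv).mul (hc.pd l))
      · exact Nice.mono (c := fun ρ => (3 + 2 * (l : ℝ)) * pdR c l ρ) _
          ((IsRat.const _).mul (hc.pd l))
      · exact Nice.mono (c := fun ρ => -((2 * k i + 1 : ℕ) : ℝ) * (ρ 0)⁻¹ * c ρ) _
          (((IsRat.const _).mul IsRat.inv).mul hc)
    · intro ρ h z hz
      have hpd : ∀ l, pdC (fun σ => (c σ : ℂ) * mon B k z) l ρ = (pdR c l ρ : ℂ) * mon B k z :=
        fun l => (hasDeriv_coef hc ρ h l (mon B k z)).deriv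
      unfold AdagVar AdagFree
      congr 1
      · rw [tsum_eq_sum (s := Finset.range M)]
        · refine Finset.sum_congr rfl fun l _ => ?_
          rw [hpd, mon_succ, mon_succ]
          push_cast
          simp only [div_eq_mul_inv, mul_inv, inv_pow]
          ring
        · intro l hl
          rw [hpd, hM l (by simpa using hl) ρ h]; simp
      · refine Finset.sum_congr rfl fun i hi => ?_
        have hi' := Finset.mem_range.1 hi
        have hd := ((hasDeriv_mon B k z i hi' (z i) (hz i hi')).const_mul (c ρ : ℂ)).deriv
        rw [Function.update_eq_self] at hd
        rw [hd, mon_succ, mon_raise B k i hi']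
        push_cast
        simp only [div_eq_mul_inv, mul_inv, inv_pow]
        ring
  | @add F H h1 h2 i1 i2 =>
    obtain ⟨F', hF', e1⟩ := i1
    obtain ⟨H', hH', e2⟩ := i2
    refine ⟨_, hF'.add hH', fun ρ h z hz => ?_⟩
    rw [← e1 ρ h z hz, ← e2 ρ h z hz]
    obtain ⟨M, hM⟩ := h1.fin
    obtain ⟨N, hN⟩ := h2.fin
    unfold AdagVar AdagFree
    simp only [pdC_add h1 h2 ρ h z]
    have e3 : ∀ i ∈ Finset.range B,
        deriv (fun v => F ρ (Function.update z i v) + H ρ (Function.update z i v)) (z i) =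
        deriv (fun v => F ρ (Function.update z i v)) (z i) +
        deriv (fun v => H ρ (Function.update z i v)) (z i) := fun i hi =>
      have hi' := Finset.mem_range.1 hi
      deriv_fun_add (h1.diffz ρ z i hi' _ (hz i hi')) (h2.diffz ρ z i hi' _ (hz i hi'))
    rw [Finset.sum_congr rfl fun i hi => by rw [e3 i hi, mul_add], Finset.sum_add_distrib]
    simp only [mul_add]
    rw [Summable.tsum_add]
    · ring
    · refine summable_of_ne_finset_zero (s := Finset.range M) fun l hl => ?_
      rw [hM l (by simpa using hl) ρ h z, mul_zero]
    · refine summable_of_ne_finset_zero (s := Finset.range N) fun l hl => ?_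
      rw [hN l (by simpa using hl) ρ h z, mul_zero]

/-- Domain: nonzero variables, and `z₀ + z₁ ≠ 0` if `s` holds. -/
def Dom (s : Prop) (B : ℕ) : Set (ℕ → ℂ) :=
  {z | (∀ j ∈ Finset.range B, z j ≠ 0) ∧ (s → z 0 + z 1 ≠ 0)}

lemma Dom.isOpen (s : Prop) (B : ℕ) : IsOpen (Dom s B) := by
  have h1 : IsOpen {z : ℕ → ℂ | ∀ j ∈ Finset.range B, z j ≠ 0} := by
    simp only [Set.ofPred_forall]
    exact isOpen_biInter_finset fun j _ => isOpen_ne_fun (continuous_apply j) continuous_const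
  have h2 : IsOpen {z : ℕ → ℂ | s → z 0 + z 1 ≠ 0} := by
    by_cases hs : s
    · simp only [hs, true_imp_iff]
      exact isOpen_ne_fun ((continuous_apply 0).add (continuous_apply 1)) continuous_const
    · simp [hs]
  exact h1.inter h2

lemma Dom.ev {s : Prop} {B : ℕ} {z : ℕ → ℂ} (hz : z ∈ Dom s B) (i : ℕ) :
    ∀ᶠ v in nhds (z i), Function.update z i v ∈ Dom s B := by
  have hc : Continuous fun v : ℂ => Function.update z i v :=
    continuous_const.update i continuous_id
  refine hc.continuousAt.eventually_mem ((Dom.isOpen s B).mem_nhds ?_)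
  simpa using hz

lemma adag_congr {s : Prop} {B : ℕ} {F H : (ℕ → ℝ) → (ℕ → ℂ) → ℂ}
    (e : ∀ ρ : ℕ → ℝ, ρ 0 ≠ 0 → ∀ z ∈ Dom s B, F ρ z = H ρ z)
    (ρ : ℕ → ℝ) (h : ρ 0 ≠ 0) (z : ℕ → ℂ) (hz : z ∈ Dom s B) :
    AdagVar (Finset.range B) B F ρ z = AdagVar (Finset.range B) B H ρ z := by
  unfold AdagVar AdagFree
  have h1 : ∀ l, pdC (fun σ => F σ z) l ρ = pdC (fun σ => H σ z) l ρ := fun l => by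
    unfold pdC
    refine Filter.EventuallyEq.deriv_eq ?_
    filter_upwards [update_zero_ev ρ h l] with t ht using e _ ht z hz
  have h2 : ∀ i, deriv (fun v => F ρ (Function.update z i v)) (z i) =
      deriv (fun v => H ρ (Function.update z i v)) (z i) := fun i => by
    refine Filter.EventuallyEq.deriv_eq ?_
    filter_upwards [Dom.ev hz i] with t ht using e _ h _ ht
  simp only [h1, h2]

/-- `F` agrees with a nice function on the domain. -/
def Agr (s : Prop) (B : ℕ) (F : (ℕ → ℝ) → (ℕ → ℂ) → ℂ) : Prop :=
  ∃ H, Nice B H ∧ ∀ ρ : ℕ → ℝ, ρ 0 ≠ 0 → ∀ z ∈ Dom s B, F ρ z = H ρ z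

lemma Agr.adag {s : Prop} {B : ℕ} {F} (hF : Agr s B F) :
    Agr s (B + 1) (AdagVar (Finset.range B) B F) := by
  obtain ⟨H, hH, e⟩ := hF
  obtain ⟨H', hH', e'⟩ := hH.adag
  refine ⟨H', hH', fun ρ h z hz => ?_⟩
  have hz' : z ∈ Dom s B := ⟨fun j hj => hz.1 j (by simp at hj ⊢; omega), hz.2⟩
  rw [adag_congr e ρ h z hz', e' ρ h z fun j hj => hz'.1 j (by simpa using hj)]

lemma agr_GBraw (lam : ℝ) (g : ℕ) : ∀ B, Agr False (B + 1) (GBraw lam g (B + 1))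
  | 0 => by
    obtain ⟨hc, K, hK⟩ := GoodTab.Gtab lam g g
    refine ⟨fun ρ z => ∑ k ∈ Finset.range K, (NCQFT.Gtab lam g g k ρ : ℂ) *
      mon 1 (fun _ => k + 1) z, Nice.sum _ _ fun k _ => Nice.mono _ (hc k), ?_⟩
    intro ρ h z hz
    show Gfun lam g ρ (z 0) = _
    unfold Gfun Gcoef
    rw [tsum_eq_sum (s := Finset.range K)]
    · refine Finset.sum_congr rfl fun k _ => ?_
      simp [mon, div_eq_mul_inv, mul_add]
    · intro k hk
      rw [hK k (by simpa using hk) ρ h]; simp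
  | (B + 1) => (agr_GBraw lam g B).adag

lemma agr_GBraw0 (lam : ℝ) : ∀ B, Agr True (B + 3) (GBraw0 lam (B + 3))
  | 0 => by
    refine ⟨fun ρ z => ((-(4 * lam ^ 2) * (ρ 0)⁻¹ : ℝ) : ℂ) * mon 3 (fun _ => 1) z,
      Nice.mono (c := fun ρ => -(4 * lam ^ 2) * (ρ 0)⁻¹) _
        ((IsRat.const _).mul IsRat.inv), ?_⟩
    intro ρ h z hz
    have h0 : z 0 ≠ 0 := hz.1 0 (by simp)
    have h1 : z 1 ≠ 0 := hz.1 1 (by simp)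
    have h2 : z 2 ≠ 0 := hz.1 2 (by simp)
    have h01 : z 0 + z 1 ≠ 0 := hz.2 trivial
    have hr : (ρ 0 : ℂ) ≠ 0 := by exact_mod_cast h
    have key : ∀ a v : ℂ, v ≠ 0 → a ≠ 0 → v + a ≠ 0 →
        HasDerivAt (fun v : ℂ => 4 * (lam : ℂ) ^ 2 / (v * a * (v + a) ^ 2))
          (-(4 * (lam : ℂ) ^ 2) * (3 * v + a) / (v ^ 2 * a * (v + a) ^ 3)) v := by
      intro a v hv ha hva
      have hd : HasDerivAt (fun v : ℂ => v * a * (v + a) ^ 2)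
          (1 * a * (v + a) ^ 2 + v * a * (((2 : ℕ) : ℂ) * (v + a) ^ (2 - 1) * 1)) v :=
        ((hasDerivAt_id v).mul_const a).mul (((hasDerivAt_id v).add_const a).pow 2)
      have := (hasDerivAt_const v (4 * (lam : ℂ) ^ 2)).div hd (by positivity)
      refine this.congr_deriv ?_
      field_simp
      push_cast
      ring
    show AdagVar (Finset.range 2) 2 (GBraw0 lam 2) ρ z = _
    unfold AdagVar AdagFree
    have d0 : deriv (fun v => GBraw0 lam 2 ρ (Function.update z 0 v)) (z 0) =
        -(4 * (lam : ℂ) ^ 2) * (3 * z 0 + z 1) / ((z 0) ^ 2 * z 1 * (z 0 + z 1) ^ 3) := by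
      have := (key (z 1) (z 0) h0 h1 h01).deriv
      rw [← this]
      simp [GBraw0]
    have d1 : deriv (fun v => GBraw0 lam 2 ρ (Function.update z 1 v)) (z 1) =
        -(4 * (lam : ℂ) ^ 2) * (3 * z 1 + z 0) / ((z 1) ^ 2 * z 0 * (z 1 + z 0) ^ 3) := by
      have := (key (z 0) (z 1) h1 h0 (by rwa [add_comm])).deriv
      rw [← this]
      congr 1
      funext v
      simp [GBraw0, mul_comm, add_comm]
    have dp : ∀ l, pdC (fun σ => GBraw0 lam 2 σ z) l ρ = 0 := fun l => by
      simp [pdC, GBraw0]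
    simp only [dp, mul_zero, tsum_zero, zero_add, Finset.sum_range_succ, Finset.sum_range_zero,
      d0, d1, mon, Finset.prod_range_succ, Finset.prod_range_zero]
    rw [add_comm (z 1) (z 0)]
    push_cast
    field_simp
    ring
  | (B + 1) => (agr_GBraw0 lam B).adag

lemma agr_GBfun (lam : ℝ) (g B : ℕ) (hB : 1 ≤ B) (hgB : 2 < 2 * g + B) :
    ∃ (a : ℂ) (F : (ℕ → ℝ) → (ℕ → ℂ) → ℂ), Agr (g = 0) B F ∧
      ∀ ρ z, GBfun lam g B ρ z = a * F ρ z := by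
  unfold GBfun
  by_cases hg : g = 0
  · obtain ⟨b, rfl⟩ : ∃ b, B = b + 3 := ⟨B - 3, by omega⟩
    simp only [hg, if_true]
    exact ⟨_, _, agr_GBraw0 lam b, fun _ _ => rfl⟩
  · obtain ⟨b, rfl⟩ : ∃ b, B = b + 1 := ⟨B - 1, by omega⟩
    have := agr_GBraw lam g b
    rw [show False = (g = 0) by simp [hg]] at this
    simp only [hg, if_false] at this ⊢
    by_cases hb : b = 0
    · subst hb
      exact ⟨1, _, this, fun _ _ => by simp [GBraw]⟩
    · simp only [show b + 1 ≠ 1 by omega, if_false]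
      exact ⟨_, _, this, fun _ _ => rfl⟩

lemma mem_Dom (g B : ℕ) (hgB : 2 < 2 * g + B) (z : ℕ → ℂ) (hz : ∀ j, j < B → z j ≠ 0)
    (hs : ∀ j k, j < B → k < B → j ≠ k → z j + z k ≠ 0) : z ∈ Dom (g = 0) B :=
  ⟨fun j hj => hz j (by simpa using hj),
    fun h => hs 0 1 (by omega) (by omega) (by omega)⟩

lemma mem_Dom_update (g B : ℕ) (hgB : 2 < 2 * g + B) (z : ℕ → ℂ) (hz : ∀ j, j < B → z j ≠ 0)
    (hs : ∀ j k, j < B → k < B → j ≠ k → z j ≠ z k ∧ z j + z k ≠ 0) (i : ℕ) (w : ℂ)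
    (hw : w ≠ 0) (hwz : ∀ j, j < B → j ≠ i → w ≠ z j ∧ w ≠ -z j) :
    Function.update z i w ∈ Dom (g = 0) B := by
  refine mem_Dom g B hgB _ (fun j hj => ?_) fun j k hj hk hjk => ?_
  · by_cases hji : j = i
    · subst hji; simpa using hw
    · rw [Function.update_of_ne hji]; exact hz j hj
  · by_cases hji : j = i
    · subst hji
      rw [Function.update_self, Function.update_of_ne (Ne.symm hjk)]
      exact fun h => (hwz k hk (Ne.symm hjk)).2 (eq_neg_of_add_eq_zero_left h)
    · rw [Function.update_of_ne hji]
      by_cases hki : k = i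
      · subst hki
        rw [Function.update_self]
        exact fun h => (hwz j hj hji).2 (eq_neg_of_add_eq_zero_right h)
      · rw [Function.update_of_ne hki]
        exact (hs j k hj hk hjk).2

end NCQFT

open NCQFT in
/-- For `2−2g−B < 0`, the multi-boundary function `𝒢_g(z₁|…|z_B)` is
(1) in each variable given by a holomorphic function on `ℂ∖{0}`, and
(2) an odd function of each variable. -/
theorem stmt14 (lam : ℝ) (hlam : lam ≠ 0) (ρ : ℕ → ℝ) (hρ0 : ρ 0 ≠ 0)
    (g B : ℕ) (hB : 1 ≤ B) (hgB : 2 < 2 * g + B) :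
    (∀ i, i < B → ∀ z : ℕ → ℂ,
      (∀ j, j < B → z j ≠ 0) →
      (∀ j k, j < B → k < B → j ≠ k → z j ≠ z k ∧ z j + z k ≠ 0) →
      ∃ h : ℂ → ℂ, DifferentiableOn ℂ h {w | w ≠ 0} ∧
        ∀ w : ℂ, w ≠ 0 → (∀ j, j < B → j ≠ i → w ≠ z j ∧ w ≠ -z j) →
          GBfun lam g B ρ (Function.update z i w) = h w) ∧
    (∀ i, i < B → ∀ z : ℕ → ℂ,
      (∀ j, j < B → z j ≠ 0) →
      (∀ j k, j < B → k < B → j ≠ k → z j ≠ z k ∧ z j + z k ≠ 0) →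
      GBfun lam g B ρ (Function.update z i (-(z i))) = -GBfun lam g B ρ z) := by
  obtain ⟨a, F, ⟨H, hH, e⟩, hG⟩ := agr_GBfun lam g B hB hgB
  refine ⟨fun i hi z hz hs => ⟨fun w => a * H ρ (Function.update z i w), ?_, ?_⟩,
    fun i hi z hz hs => ?_⟩
  · intro w hw
    exact ((hH.diffz ρ z i hi w hw).const_mul a).differentiableWithinAt
  · intro w hw hwz
    rw [hG, e ρ hρ0 _ (mem_Dom_update g B hgB z hz hs i w hw hwz)]
  · rw [hG, hG, e ρ hρ0 z (mem_Dom g B hgB z hz fun j k hj hk hjk => (hs j k hj hk hjk).2),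
      e ρ hρ0 _ (mem_Dom_update g B hgB z hz hs i _ (neg_ne_zero.2 (hz i hi)) ?_),
      hH.odd ρ z i hi, mul_neg]
    intro j hj hji
    have := hs i j hi hj (Ne.symm hji)
    refine ⟨fun h => this.2 ?_, fun h => this.1 (neg_injective h)⟩
    rw [← h]; ring
end
end

section
/- Assume ϱ₀ ≠ 0 and λ ∈ ℝ. Let I be a finite index set, M ∈ ℕ, F a smooth function of (ϱ₀, …, ϱ_M; (z_i)_{i∈I}), and set Φ(w) := (2λ)³·Â†_{z_I,w}F. Then for all nonzero z₁, z_β with z₁ ≠ ±z_β and all nonzero z_i (i ∈ I): (8λ³/z_β)·(∂/∂z_β)[(Φ(z₁) − Φ(z_β))/(z₁²−z_β²)] + 2λ·(4λ²/(z₁z_β(z₁+z_β)²))·Φ(z₁) = (2λ)⁶·[ Σ_{l=0}^{M}( −Σ_{n=0}^{1}(3+2l)(1+2n)·ϱ_{l+1}/(ϱ₀·z₁^{4−2n}·z_β^{3+2n}) + Σ_{n=0}^{l+2}(3+2l)(1+2n)/(z₁^{6+2l−2n}·z_β^{3+2n}) )·∂F/∂ϱ_l + Σ_{i∈I}Σ_{n=0}^{1}(1+2n)/(ϱ₀·z_i·z₁^{4−2n}·z_β^{3+2n})·∂F/∂z_i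 ]. -/
open scoped BigOperators
open MeasureTheory

noncomputable section

namespace NCQFT

/-- `P16 u v f R`: `f` is differentiable at `v` and the linear operator of the lemma maps `f` to
`R`. -/
def P16 (u v : ℂ) (f : ℂ → ℂ) (R : ℂ) : Prop :=
  ∃ d, HasDerivAt f d v ∧
    (-d * (u ^ 2 - v ^ 2) + (f u - f v) * (2 * v)) / (u ^ 2 - v ^ 2) ^ 2 / v
      + f u / (u * v * (u + v) ^ 2) = R

theorem P16.add {u v : ℂ} {f g : ℂ → ℂ} {R S : ℂ} (hf : P16 u v f R) (hg : P16 u v g S) :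
    P16 u v (fun t => f t + g t) (R + S) := by
  obtain ⟨d, hd, rfl⟩ := hf
  obtain ⟨e, he, rfl⟩ := hg
  exact ⟨d + e, hd.add he, by ring⟩

theorem P16.mul {u v : ℂ} {f : ℂ → ℂ} {R : ℂ} (c : ℂ) (hf : P16 u v f R) :
    P16 u v (fun t => c * f t) (c * R) := by
  obtain ⟨d, hd, rfl⟩ := hf
  exact ⟨c * d, hd.const_mul c, by ring⟩

theorem P16.sum {u v : ℂ} {s : Finset ℕ} {f : ℕ → ℂ → ℂ} {R : ℕ → ℂ}
    (h : ∀ i ∈ s, P16 u v (f i) (R i)) :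
    P16 u v (fun t => ∑ i ∈ s, f i t) (∑ i ∈ s, R i) := by
  classical
  induction s using Finset.induction_on with
  | empty => exact ⟨0, by simpa using hasDerivAt_const v (0 : ℂ), by simp⟩
  | insert a s ha ih =>
    simp only [Finset.sum_insert ha]
    exact (h a (by simp)).add (ih fun i hi => h i (by simp [hi]))

theorem key16 (u v : ℂ) (hu : u ≠ 0) (hv : v ≠ 0) (h1 : u ^ 2 - v ^ 2 ≠ 0) (h2 : u + v ≠ 0)
    (h3 : u - v ≠ 0) (k : ℕ) :
    ((2 * (k : ℂ) + 3) / v ^ (2 * k + 4) * (u ^ 2 - v ^ 2)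
        + (1 / u ^ (2 * k + 3) - 1 / v ^ (2 * k + 3)) * (2 * v)) / (u ^ 2 - v ^ 2) ^ 2 / v
      + 1 / u ^ (2 * k + 3) / (u * v * (u + v) ^ 2)
    = ∑ n ∈ Finset.range (k + 2), (1 + 2 * (n : ℂ)) / (u ^ (2 * k + 4 - 2 * n) * v ^ (3 + 2 * n)) := by
  have hfac : u ^ 2 - v ^ 2 = (u - v) * (u + v) := by ring
  induction k with
  | zero =>
    simp only [Finset.sum_range_succ, Finset.sum_range_zero, hfac]
    norm_num
    field_simp
    ring
  | succ k ih =>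
    rw [Finset.sum_range_succ]
    have e : ∑ n ∈ Finset.range (k + 2),
        (1 + 2 * (n : ℂ)) / (u ^ (2 * (k + 1) + 4 - 2 * n) * v ^ (3 + 2 * n))
        = (∑ n ∈ Finset.range (k + 2),
          (1 + 2 * (n : ℂ)) / (u ^ (2 * k + 4 - 2 * n) * v ^ (3 + 2 * n))) * (1 / u ^ 2) := by
      rw [Finset.sum_mul]
      refine Finset.sum_congr rfl fun n hn => ?_
      have hn' := Finset.mem_range.1 hn
      have : 2 * (k + 1) + 4 - 2 * n = (2 * k + 4 - 2 * n) + 2 := by omega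
      rw [this, pow_add u]
      field_simp
    rw [e, ← ih, show 2 * (k + 1) + 4 - 2 * (k + 2) = 2 by omega,
      show 2 * (k + 1) + 4 = 2 * k + 6 by ring, show 2 * (k + 1) + 3 = 2 * k + 5 by ring,
      show 3 + 2 * (k + 2) = 2 * k + 7 by ring]
    push_cast
    simp only [pow_add]
    generalize u ^ (2 * k) = a at *
    rw [hfac]
    have hb : v ^ (2 * k) ≠ 0 := pow_ne_zero _ hv
    generalize v ^ (2 * k) = b at *
    by_cases ha : a = 0
    · subst ha
      simp only [zero_mul, div_zero]
      field_simp
      ring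
    field_simp
    ring

theorem P16_pow (u v : ℂ) (hu : u ≠ 0) (hv : v ≠ 0) (h1 : u ^ 2 - v ^ 2 ≠ 0) (h2 : u + v ≠ 0)
    (h3 : u - v ≠ 0) (k : ℕ) :
    P16 u v (fun t => 1 / t ^ (2 * k + 3))
      (∑ n ∈ Finset.range (k + 2),
        (1 + 2 * (n : ℂ)) / (u ^ (2 * k + 4 - 2 * n) * v ^ (3 + 2 * n))) := by
  refine ⟨-((2 * (k : ℂ) + 3) / v ^ (2 * k + 4)), ?_, ?_⟩
  · have h := (hasDerivAt_pow (2 * k + 3) v).fun_inv (pow_ne_zero _ hv)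
    simp only [one_div]
    refine h.congr_deriv ?_
    simp only [show 2 * k + 3 - 1 = 2 * k + 2 by omega]
    push_cast
    simp only [pow_add]
    have hb : v ^ (2 * k) ≠ 0 := pow_ne_zero _ hv
    field_simp
  · rw [← key16 u v hu hv h1 h2 h3 k, neg_neg]

theorem P16_Adag (ρ : ℕ → ℝ) (I : Finset ℕ) (M : ℕ)
    (F : (ℕ → ℝ) → (ℕ → ℂ) → ℂ) (hF : SmoothFam M I F) (z : ℕ → ℂ)
    (u v : ℂ) (hu : u ≠ 0) (hv : v ≠ 0) (h1 : u ^ 2 - v ^ 2 ≠ 0) (h2 : u + v ≠ 0)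
    (h3 : u - v ≠ 0) :
    P16 u v (AdagFree I F ρ z)
      ((∑ l ∈ Finset.range (M + 1),
          ((-(∑ n ∈ Finset.range 2, (3 + 2 * (l : ℂ)) * (1 + 2 * (n : ℂ)) *
                (ρ (l + 1) : ℂ) / ((ρ 0 : ℂ) * u ^ (4 - 2 * n) * v ^ (3 + 2 * n))))
            + ∑ n ∈ Finset.range (l + 3), (3 + 2 * (l : ℂ)) * (1 + 2 * (n : ℂ)) /
                (u ^ (6 + 2 * l - 2 * n) * v ^ (3 + 2 * n))) *
          pdC (fun σ => F σ z) l ρ)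
       + ∑ i ∈ I, (∑ n ∈ Finset.range 2, (1 + 2 * (n : ℂ)) /
            ((ρ 0 : ℂ) * z i * u ^ (4 - 2 * n) * v ^ (3 + 2 * n))) *
          deriv (fun w => F ρ (Function.update z i w)) (z i)) := by
  have hzero : ∀ l, M < l → pdC (fun σ => F σ z) l ρ = 0 := by
    intro l hl
    obtain ⟨Ft, -, -, h⟩ := hF
    have : (fun t : ℝ => F (Function.update ρ l t) z) = fun _ => F ρ z := by
      funext t
      rw [h, h]
      congr 2
      funext j
      rw [Function.update_of_ne]
      have := j.2
      omega
    simp only [pdC, this, deriv_const]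
  have hA : AdagFree I F ρ z = fun w =>
      (∑ l ∈ Finset.range (M + 1),
        ((-((3 + 2 * (l : ℂ)) * (ρ (l + 1) : ℂ) / (ρ 0 : ℂ)) * pdC (fun σ => F σ z) l ρ)
            * (1 / w ^ (2 * 0 + 3))
          + ((3 + 2 * (l : ℂ)) * pdC (fun σ => F σ z) l ρ) * (1 / w ^ (2 * (l + 1) + 3))))
      + ∑ i ∈ I, (1 / ((ρ 0 : ℂ) * z i) * deriv (fun v => F ρ (Function.update z i v)) (z i))
          * (1 / w ^ (2 * 0 + 3)) := by
    funext w
    unfold AdagFree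
    rw [tsum_eq_sum (s := Finset.range (M + 1))]
    · congr 1
      · refine Finset.sum_congr rfl fun l _ => ?_
        rw [show 2 * (l + 1) + 3 = 5 + 2 * l by ring]
        simp only [div_eq_mul_inv, mul_inv]
        ring
      · refine Finset.sum_congr rfl fun i _ => ?_
        simp only [div_eq_mul_inv, mul_inv]
        ring
    · intro l hl
      rw [hzero l (by simpa using hl), mul_zero]
  rw [hA]
  have hp := P16_pow u v hu hv h1 h2 h3
  have := (P16.sum (s := Finset.range (M + 1)) fun l _ =>
    ((hp 0).mul (-((3 + 2 * (l : ℂ)) * (ρ (l + 1) : ℂ) / (ρ 0 : ℂ)) * pdC (fun σ => F σ z) l ρ)).add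
      ((hp (l + 1)).mul ((3 + 2 * (l : ℂ)) * pdC (fun σ => F σ z) l ρ))).add
    (P16.sum (s := I) fun i _ => (hp 0).mul
      (1 / ((ρ 0 : ℂ) * z i) * deriv (fun v => F ρ (Function.update z i v)) (z i)))
  convert this using 1
  congr 1
  · refine Finset.sum_congr rfl fun l _ => ?_
    rw [add_mul, neg_mul, Finset.sum_mul, Finset.sum_mul, Finset.mul_sum, Finset.mul_sum,
      ← Finset.sum_neg_distrib]
    congr 1
    · refine Finset.sum_congr rfl fun n _ => ?_
      simp only [div_eq_mul_inv, mul_inv, mul_zero, zero_add]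
      ring
    · refine Finset.sum_congr rfl fun n _ => ?_
      rw [show 2 * (l + 1) + 4 - 2 * n = 6 + 2 * l - 2 * n by omega]
      ring
  · refine Finset.sum_congr rfl fun i _ => ?_
    rw [Finset.sum_mul, Finset.mul_sum]
    refine Finset.sum_congr rfl fun n _ => ?_
    simp only [div_eq_mul_inv, mul_inv, mul_zero, zero_add]
    ring

end NCQFT

open NCQFT in
/-- (Lemma 6)  With `Φ(w) := (2λ)³Â†_{z_I,w}F`, the combination
`(8λ³/z_β)∂_{z_β}[(Φ(z₁)−Φ(z_β))/(z₁²−z_β²)] + 2λ𝒢₀(z₁|z_β)Φ(z₁)` equals the stated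
explicit expression in the derivatives of `F`. Here `u = z₁`, `v = z_β`. -/
theorem stmt16 (lam : ℝ) (ρ : ℕ → ℝ) (hρ0 : ρ 0 ≠ 0)
    (I : Finset ℕ) (M : ℕ)
    (F : (ℕ → ℝ) → (ℕ → ℂ) → ℂ) (hF : SmoothFam M I F)
    (z : ℕ → ℂ) (hzI : ∀ i ∈ I, z i ≠ 0)
    (u v : ℂ) (hu : u ≠ 0) (hv : v ≠ 0) (huv : u ≠ v) (huv' : u ≠ -v) :
    (8 * (lam : ℂ) ^ 3 / v) *
        deriv (fun t : ℂ =>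
          ((2 * (lam : ℂ)) ^ 3 * AdagFree I F ρ z u
            - (2 * (lam : ℂ)) ^ 3 * AdagFree I F ρ z t) / (u ^ 2 - t ^ 2)) v
      + 2 * (lam : ℂ) * (4 * (lam : ℂ) ^ 2 / (u * v * (u + v) ^ 2)) *
          ((2 * (lam : ℂ)) ^ 3 * AdagFree I F ρ z u)
    = (2 * (lam : ℂ)) ^ 6 *
      ((∑ l ∈ Finset.range (M + 1),
          ((-(∑ n ∈ Finset.range 2, (3 + 2 * (l : ℂ)) * (1 + 2 * (n : ℂ)) *
                (ρ (l + 1) : ℂ) / ((ρ 0 : ℂ) * u ^ (4 - 2 * n) * v ^ (3 + 2 * n))))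
            + ∑ n ∈ Finset.range (l + 3), (3 + 2 * (l : ℂ)) * (1 + 2 * (n : ℂ)) /
                (u ^ (6 + 2 * l - 2 * n) * v ^ (3 + 2 * n))) *
          pdC (fun σ => F σ z) l ρ)
       + ∑ i ∈ I, (∑ n ∈ Finset.range 2, (1 + 2 * (n : ℂ)) /
            ((ρ 0 : ℂ) * z i * u ^ (4 - 2 * n) * v ^ (3 + 2 * n))) *
          deriv (fun w => F ρ (Function.update z i w)) (z i)) := by
  have h2 : u + v ≠ 0 := fun h => huv' (eq_neg_of_add_eq_zero_left h)
  have h3 : u - v ≠ 0 := sub_ne_zero.2 huv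
  have h1 : u ^ 2 - v ^ 2 ≠ 0 := by
    rw [show u ^ 2 - v ^ 2 = (u + v) * (u - v) by ring]
    exact mul_ne_zero h2 h3
  obtain ⟨d, hd, hR⟩ := P16_Adag ρ I M F hF z u v hu hv h1 h2 h3
  rw [← hR]
  have hq := ((hd.const_mul ((2 * (lam : ℂ)) ^ 3)).const_sub
    ((2 * (lam : ℂ)) ^ 3 * AdagFree I F ρ z u)).fun_div
    ((hasDerivAt_pow 2 v).const_sub (u ^ 2)) h1
  rw [hq.deriv]
  simp only [Nat.add_one_sub_one, pow_one, Nat.cast_ofNat]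
  ring
end
end

section
/- Take the parameters ϱ_l in the differential operators to be the moments of the measure, with ϱ₀ ≠ 0, and let λ ∈ ℝ. Let I be a finite index set (not containing the labels 1 and B), M ∈ ℕ, F a smooth function of (ϱ₀, …, ϱ_M; (z_i)_{i∈I}), and set Φ := (2λ)³·Â†_{z_I,z₁}F. Then the commutator of K̂ (acting on the z₁-dependence) with the boundary creation operator in the variable z_B satisfies, for admissible z₁ and nonzero z_B, z_i: (2λ)³·[K̂_{z₁}(Â†_{z_{I∪{1}},z_B}Φ) − Â†_{z_{I∪{1}},z_B}(K̂_{z₁}Φ)] = (2λ)⁶·[ Σ_{l}((3+2l)/(z₁²z_B³))·(ϱ_{l+1}/(ϱ₀z₁²) + 3ϱ_{l+1}/(ϱ₀z_B²) − 1/z₁^{4+2l} − (5+2l)/z_B^{4+2l})·∂F/∂ϱ_l − Σ_{l}Σ_{k=0}^{l}(3+2l)(3+2k)/(z₁^{4+2l−2k}·z_B^{5+2k})·∂F/∂ϱ_l − Σ_{i∈I}(1/(ϱ₀z₁²z_i z_B³))·(1/z₁² + 3/z_B²)·∂F/∂z_i ], where the l-sums run over the (finitely many) l with ∂F/∂ϱ_l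 ≠ 0. -/
open scoped BigOperators
open MeasureTheory

noncomputable section

namespace NCQFT

/-- Projection to the finitely many relevant coordinates. -/
def Pt (M : ℕ) (I : Finset ℕ) (σ : ℕ → ℝ) (τ : ℕ → ℂ) :
    (Fin (M + 1) → ℝ) × ({ i // i ∈ I } → ℂ) := (fun l => σ (l : ℕ), fun i => τ (i : ℕ))

/-- The region of smoothness. -/
def URegion (M : ℕ) (I : Finset ℕ) : Set ((Fin (M + 1) → ℝ) × ({ i // i ∈ I } → ℂ)) :=
  { x | x.1 0 ≠ 0 ∧ ∀ i, x.2 i ≠ 0 }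

/-- Direction of the `l`-th moment. -/
def eS (M : ℕ) (I : Finset ℕ) (l : ℕ) : (Fin (M + 1) → ℝ) × ({ i // i ∈ I } → ℂ) :=
  (fun k => if (k : ℕ) = l then 1 else 0, 0)

/-- Embedding of the `i`-th boundary coordinate. -/
def eT (M : ℕ) (I : Finset ℕ) (i : { i // i ∈ I }) :
    ℂ →L[ℝ] (Fin (M + 1) → ℝ) × ({ i // i ∈ I } → ℂ) :=
  (0 : ℂ →L[ℝ] (Fin (M + 1) → ℝ)).prod
    (ContinuousLinearMap.pi fun k => if k = i then ContinuousLinearMap.id ℝ ℂ else 0)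

lemma isOpen_URegion (M : ℕ) (I : Finset ℕ) : IsOpen (URegion M I) := by
  have h : URegion M I = {x | x.1 0 ≠ 0} ∩ ⋂ i, {x | x.2 i ≠ 0} := by
    ext x; simp [URegion]
  rw [h]
  refine IsOpen.inter ?_ (isOpen_iInter_of_finite fun i => ?_)
  · exact isOpen_ne_fun (by fun_prop) continuous_const
  · exact isOpen_ne_fun (by fun_prop) continuous_const

lemma Pt_mem {M : ℕ} {I : Finset ℕ} {σ : ℕ → ℝ} {τ : ℕ → ℂ} (h0 : σ 0 ≠ 0)
    (hI : ∀ i ∈ I, τ i ≠ 0) : Pt M I σ τ ∈ URegion M I :=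
  ⟨by simpa [Pt] using h0, fun i => hI i i.2⟩

lemma Pt_update_fst (M : ℕ) (I : Finset ℕ) (σ : ℕ → ℝ) (τ : ℕ → ℂ) (l : ℕ) :
    HasDerivAt (fun t : ℝ => Pt M I (Function.update σ l t) τ) (eS M I l) (σ l) := by
  unfold Pt eS
  refine HasDerivAt.prodMk ?_ (hasDerivAt_const _ _)
  rw [hasDerivAt_pi]
  intro k
  by_cases hk : (k : ℕ) = l
  · simp only [hk, Function.update_self, if_true]; exact hasDerivAt_id _
  · simp only [Function.update_of_ne hk, hk, if_false]; exact hasDerivAt_const _ _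

lemma upd_snd (M : ℕ) (I : Finset ℕ) (x : (Fin (M + 1) → ℝ) × ({ i // i ∈ I } → ℂ))
    (i : { i // i ∈ I }) :
    HasFDerivAt (fun v : ℂ => (x.1, Function.update x.2 i v)) (eT M I i) (x.2 i) := by
  unfold eT
  refine HasFDerivAt.prodMk (hasFDerivAt_const _ _) ?_
  rw [hasFDerivAt_pi]
  intro k
  by_cases hk : k = i
  · subst hk
    simp only [Function.update_self, if_true]; exact hasFDerivAt_id _
  · simp only [Function.update_of_ne hk, hk, if_false]; exact hasFDerivAt_const _ _

lemma Pt_update_snd_eq (M : ℕ) (I : Finset ℕ) (σ : ℕ → ℝ) (τ : ℕ → ℂ)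
    (i : { i // i ∈ I }) (v : ℂ) :
    Pt M I σ (Function.update τ i v) =
      ((Pt M I σ τ).1, Function.update (Pt M I σ τ).2 i v) := by
  unfold Pt
  ext k
  · rfl
  · by_cases hk : k = i
    · subst hk; simp
    · have : (k : ℕ) ≠ i := fun h => hk (Subtype.ext h)
      simp [Function.update_of_ne hk, Function.update_of_ne this]

section smooth
variable {M : ℕ} {I : Finset ℕ} {Ft : ((Fin (M + 1) → ℝ) × ({ i // i ∈ I } → ℂ)) → ℂ}

lemma Ft_deriv (h1 : ContDiffOn ℝ (⊤ : ℕ∞) Ft (URegion M I))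
    (h2 : ∀ x ∈ URegion M I, ∀ i,
      DifferentiableAt ℂ (fun w => Ft (x.1, Function.update x.2 i w)) (x.2 i))
    {x : (Fin (M + 1) → ℝ) × ({ i // i ∈ I } → ℂ)} (hx : x ∈ URegion M I) (i : { i // i ∈ I })
    (c : ℂ) :
    fderiv ℝ Ft x (eT M I i c) =
      c * deriv (fun w => Ft (x.1, Function.update x.2 i w)) (x.2 i) := by
  have hd : DifferentiableAt ℝ Ft x :=
    (h1.differentiableOn (by simp)).differentiableAt ((isOpen_URegion M I).mem_nhds hx)
  have e1 := ((h2 x hx i).hasDerivAt.hasFDerivAt).restrictScalars ℝ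
  have hx' : (x.1, Function.update x.2 i (x.2 i)) = x := by simp
  have e2 : HasFDerivAt (fun w => Ft (x.1, Function.update x.2 i w))
      ((fderiv ℝ Ft x).comp (eT M I i)) (x.2 i) := by
    refine HasFDerivAt.comp (x.2 i) (g := Ft) ?_ (upd_snd M I x i)
    rw [hx']; exact hd.hasFDerivAt
  have e3 := congrArg (fun L => L c) (e2.unique e1)
  simpa using e3

lemma hol_fderiv (h1 : ContDiffOn ℝ (⊤ : ℕ∞) Ft (URegion M I))
    (h2 : ∀ x ∈ URegion M I, ∀ i,
      DifferentiableAt ℂ (fun w => Ft (x.1, Function.update x.2 i w)) (x.2 i))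
    {x : (Fin (M + 1) → ℝ) × ({ i // i ∈ I } → ℂ)} (hx : x ∈ URegion M I) (i : { i // i ∈ I })
    (u : (Fin (M + 1) → ℝ) × ({ i // i ∈ I } → ℂ)) :
    DifferentiableAt ℂ (fun w => fderiv ℝ Ft (x.1, Function.update x.2 i w) u) (x.2 i) := by
  have hU := (isOpen_URegion M I).mem_nhds hx
  have hc : ContDiffAt ℝ 2 Ft x := contDiffAt_infty.1 (h1.contDiffAt hU) 2
  have hd2 : DifferentiableAt ℝ (fderiv ℝ Ft) x :=
    (hc.fderiv_right (m := 1) (one_add_one_eq_two.le)).differentiableAt (by simp)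
  have hx' : (x.1, Function.update x.2 i (x.2 i)) = x := by simp
  have hsym : IsSymmSndFDerivAt ℝ Ft x :=
    hc.isSymmSndFDerivAt (by simp)
  -- Cauchy-Riemann near x
  have hCR : ∀ c : ℂ, (fun y => fderiv ℝ Ft y (eT M I i c)) =ᶠ[nhds x]
      fun y => c * fderiv ℝ Ft y (eT M I i 1) := by
    intro c
    filter_upwards [hU] with y hy
    rw [Ft_deriv h1 h2 hy, Ft_deriv h1 h2 hy, one_mul]
  have hCR2 : ∀ c : ℂ, fderiv ℝ (fderiv ℝ Ft) x u (eT M I i c) =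
      c * fderiv ℝ (fderiv ℝ Ft) x u (eT M I i 1) := by
    intro c
    have e1 : ∀ v, HasFDerivAt (fun y => fderiv ℝ Ft y v)
        ((fderiv ℝ (fderiv ℝ Ft) x).flip v) x := by
      intro v
      have := hd2.hasFDerivAt.clm_apply (hasFDerivAt_const v x)
      simpa using this
    have e2 := (e1 (eT M I i c)).congr_of_eventuallyEq (hCR c).symm
    have e3 := (e1 (eT M I i 1)).const_mul c
    have e4 := congrArg (fun L => L u) (e2.unique e3)
    simpa using e4
  have key : HasFDerivAt (fun w => fderiv ℝ Ft (x.1, Function.update x.2 i w) u)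
      (((fderiv ℝ (fderiv ℝ Ft) x).flip u).comp (eT M I i)) (x.2 i) := by
    have e1 : HasFDerivAt (fun y => fderiv ℝ Ft y u)
        ((fderiv ℝ (fderiv ℝ Ft) x).flip u) x := by
      have := hd2.hasFDerivAt.clm_apply (hasFDerivAt_const u x)
      simpa using this
    refine HasFDerivAt.comp (x.2 i) (g := fun y => fderiv ℝ Ft y u) ?_ (upd_snd M I x i)
    rw [hx']; exact e1
  have hder : HasDerivAt (fun w => fderiv ℝ Ft (x.1, Function.update x.2 i w) u)
      (fderiv ℝ (fderiv ℝ Ft) x u (eT M I i 1)) (x.2 i) := by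
    rw [hasDerivAt_iff_hasFDerivAt]
    refine hasFDerivAt_of_restrictScalars ℝ key ?_
    ext c
    simp only [ContinuousLinearMap.coe_restrictScalars', ContinuousLinearMap.toSpanSingleton_apply,
      smul_eq_mul, ContinuousLinearMap.comp_apply, ContinuousLinearMap.flip_apply, hsym.eq _ u]
    exact (hCR2 c).symm
  exact hder.differentiableAt

end smooth

/-- Differentiability package. -/
structure Nice_s17 (N : ℕ) (J : Finset ℕ) (ρ : ℕ → ℝ) (z : ℕ → ℂ)
    (f : (ℕ → ℝ) → (ℕ → ℂ) → ℂ) : Prop where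
  dσ : ∀ l, DifferentiableAt ℝ (fun t : ℝ => f (Function.update ρ l t) z) (ρ l)
  v : ∀ l, N ≤ l → pdC (fun σ => f σ z) l ρ = 0
  dz : ∀ i ∈ J, DifferentiableAt ℂ (fun v => f ρ (Function.update z i v)) (z i)

lemma ev_upd (ρ : ℕ → ℝ) (h0 : ρ 0 ≠ 0) (l : ℕ) :
    ∀ᶠ t in nhds (ρ l), Function.update ρ l t 0 ≠ 0 := by
  by_cases h : l = 0
  · subst h
    simpa using eventually_ne_nhds h0
  · simp [Function.update_of_ne (Ne.symm h), h0]

lemma ev_updz (z : ℕ → ℂ) (I : Finset ℕ) (hI : ∀ i ∈ I, z i ≠ 0) (j : ℕ) :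
    ∀ᶠ t in nhds (z j), ∀ i ∈ I, Function.update z j t i ≠ 0 := by
  have hj : ∀ᶠ t in nhds (z j), j ∈ I → t ≠ 0 := by
    by_cases hj : j ∈ I
    · filter_upwards [eventually_ne_nhds (hI j hj)] with t ht _ using ht
    · simp [hj]
  filter_upwards [hj] with t ht i hi
  by_cases h : i = j
  · subst h; simpa using ht hi
  · simpa [Function.update_of_ne h] using hI i hi

lemma SmoothFam.nice {M : ℕ} {I : Finset ℕ} {F : (ℕ → ℝ) → (ℕ → ℂ) → ℂ}
    (hF : SmoothFam M I F) {ρ : ℕ → ℝ} {z : ℕ → ℂ} (h0 : ρ 0 ≠ 0) (hI : ∀ i ∈ I, z i ≠ 0) :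
    (∀ l, Nice_s17 (M + 1) I ρ z (fun σ τ => pdC (fun σ' => F σ' τ) l σ)) ∧
    (∀ i ∈ I, Nice_s17 (M + 1) I ρ z
      (fun σ τ => deriv (fun v => F σ (Function.update τ i v)) (τ i))) ∧
    (∀ σ τ, σ 0 ≠ 0 → (∀ i ∈ I, τ i ≠ 0) → ∀ l, M + 1 ≤ l → pdC (fun σ' => F σ' τ) l σ = 0) ∧
    (∀ σ τ j w, j ∉ I → F σ (Function.update τ j w) = F σ τ) := by
  obtain ⟨Ft, h1, h2, h3⟩ := hF
  change ContDiffOn ℝ (⊤ : ℕ∞) Ft (URegion M I) at h1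
  change ∀ x ∈ URegion M I, ∀ i,
      DifferentiableAt ℂ (fun w => Ft (x.1, Function.update x.2 i w)) (x.2 i) at h2
  change ∀ σ τ, F σ τ = Ft (Pt M I σ τ) at h3
  have eS0 : ∀ l, M + 1 ≤ l → eS M I l = 0 := by
    intro l hl
    unfold eS
    ext k
    · have : (k : ℕ) ≠ l := by have := k.2; omega
      simp [this]
    · rfl
  have hchain : ∀ {G : Type} [NormedAddCommGroup G] [NormedSpace ℝ G]
      (g : ((Fin (M + 1) → ℝ) × ({ i // i ∈ I } → ℂ)) → G) (σ τ l),
      DifferentiableAt ℝ g (Pt M I σ τ) →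
      HasDerivAt (fun t : ℝ => g (Pt M I (Function.update σ l t) τ))
        (fderiv ℝ g (Pt M I σ τ) (eS M I l)) (σ l) := by
    intro G _ _ g σ τ l hg
    refine HasFDerivAt.comp_hasDerivAt (σ l) (l := g) ?_ (Pt_update_fst M I σ τ l)
    rw [Function.update_eq_self]; exact hg.hasFDerivAt
  have hdiff : ∀ σ τ, σ 0 ≠ 0 → (∀ i ∈ I, τ i ≠ 0) → DifferentiableAt ℝ Ft (Pt M I σ τ) :=
    fun σ τ a b => (h1.differentiableOn (by simp)).differentiableAt
      ((isOpen_URegion M I).mem_nhds (Pt_mem a b))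
  have hpd : ∀ σ τ, σ 0 ≠ 0 → (∀ i ∈ I, τ i ≠ 0) → ∀ l,
      pdC (fun σ' => F σ' τ) l σ = fderiv ℝ Ft (Pt M I σ τ) (eS M I l) := by
    intro σ τ a b l
    unfold pdC
    simp only [h3]
    exact (hchain Ft σ τ l (hdiff σ τ a b)).deriv
  have hpz : ∀ σ τ, σ 0 ≠ 0 → (∀ i ∈ I, τ i ≠ 0) → ∀ i, ∀ hi : i ∈ I,
      deriv (fun v => F σ (Function.update τ i v)) (τ i)
        = fderiv ℝ Ft (Pt M I σ τ) (eT M I ⟨i, hi⟩ 1) := by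
    intro σ τ a b i hi
    rw [Ft_deriv h1 h2 (Pt_mem a b), one_mul]
    simp only [h3]
    have := fun v => Pt_update_snd_eq M I σ τ ⟨i, hi⟩ v
    simp only [this]
    rfl
  have hnice : ∀ (f : (ℕ → ℝ) → (ℕ → ℂ) → ℂ) u,
      (∀ σ τ, σ 0 ≠ 0 → (∀ i ∈ I, τ i ≠ 0) → f σ τ = fderiv ℝ Ft (Pt M I σ τ) u) →
      Nice_s17 (M + 1) I ρ z f := by
    intro f u hf
    have hd2 : DifferentiableAt ℝ (fun x => fderiv ℝ Ft x u) (Pt M I ρ z) := by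
      have hc : ContDiffAt ℝ 2 Ft (Pt M I ρ z) :=
        contDiffAt_infty.1 (h1.contDiffAt ((isOpen_URegion M I).mem_nhds (Pt_mem h0 hI))) 2
      have : DifferentiableAt ℝ (fderiv ℝ Ft) (Pt M I ρ z) :=
        (hc.fderiv_right (m := 1) (one_add_one_eq_two.le)).differentiableAt (by simp)
      exact this.clm_apply (differentiableAt_const _)
    have hD : ∀ l, HasDerivAt (fun t : ℝ => f (Function.update ρ l t) z)
        (fderiv ℝ (fun x => fderiv ℝ Ft x u) (Pt M I ρ z) (eS M I l)) (ρ l) := by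
      intro l
      refine (hchain _ ρ z l hd2).congr_of_eventuallyEq ?_
      filter_upwards [ev_upd ρ h0 l] with t ht
      exact hf _ _ ht hI
    refine ⟨fun l => (hD l).differentiableAt, fun l hl => ?_, fun i hi => ?_⟩
    · have := (hD l).deriv
      rw [eS0 l hl, map_zero] at this
      exact this
    · refine (hol_fderiv h1 h2 (Pt_mem h0 hI) ⟨i, hi⟩ u).congr_of_eventuallyEq ?_
      have := ev_updz z I hI i
      filter_upwards [this] with t ht
      rw [hf _ _ h0 ht]
      rw [Pt_update_snd_eq M I ρ z ⟨i, hi⟩ t]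
  refine ⟨fun l => hnice _ (eS M I l) fun σ τ a b => hpd σ τ a b l,
    fun i hi => hnice _ (eT M I ⟨i, hi⟩ 1) fun σ τ a b => hpz σ τ a b i hi, ?_, ?_⟩
  · intro σ τ a b l hl
    rw [hpd σ τ a b, eS0 l hl, map_zero]
  · intro σ τ j w hj
    rw [h3, h3]
    congr 1
    unfold Pt
    ext k
    · rfl
    · have : (k : ℕ) ≠ j := fun h => hj (h ▸ k.2)
      simp [Function.update_of_ne this]

/-! ### The moment side of the operator `K̂` -/

/-- Image of `z^{-3-2k}` under `K̂`, with formal moments. -/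
def kap (k : ℕ) (σ : ℕ → ℝ) (w : ℂ) : ℂ :=
  ∑ j ∈ Finset.range (k + 1), (σ j : ℂ) * (1 / w ^ (2 + 2 * k - 2 * j))

lemma kap_point (z y : ℂ) (hz : z ≠ 0) (hy : y ≠ 0) (h1 : z + y ≠ 0) (h2 : z ^ 2 - y ^ 2 ≠ 0)
    (k : ℕ) :
    1 / z ^ (3 + 2 * k) * (1 / ((z + y) * y))
      + (1 / z ^ (3 + 2 * k) - 1 / y ^ (3 + 2 * k)) / (z ^ 2 - y ^ 2)
    = - ∑ j ∈ Finset.range (k + 1), 1 / y ^ (3 + 2 * j) * (1 / z ^ (2 + 2 * k - 2 * j)) := by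
  induction k with
  | zero =>
    simp only [Nat.mul_zero, Nat.add_zero, zero_add, Finset.sum_range_one, Nat.sub_zero]
    have h3 : z - y ≠ 0 := by
      intro h; apply h2; linear_combination (z + y) * h
    have : z ^ 2 - y ^ 2 = (z + y) * (z - y) := by ring
    rw [this]
    field_simp
    ring
  | succ k ih =>
    rw [Finset.sum_range_succ]
    have e : ∑ j ∈ Finset.range (k + 1), 1 / y ^ (3 + 2 * j) * (1 / z ^ (2 + 2 * (k + 1) - 2 * j))
        = 1 / z ^ 2 * ∑ j ∈ Finset.range (k + 1),
          1 / y ^ (3 + 2 * j) * (1 / z ^ (2 + 2 * k - 2 * j)) := by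
      rw [Finset.mul_sum]
      refine Finset.sum_congr rfl fun j hj => ?_
      have hj' : j ≤ k := by simpa [Nat.lt_succ_iff] using hj
      have : 2 + 2 * (k + 1) - 2 * j = 2 + (2 + 2 * k - 2 * j) := by omega
      rw [this, pow_add z 2]
      ring
    have e2 : 2 + 2 * (k + 1) - 2 * (k + 1) = 2 := by omega
    rw [e, e2, neg_add, ← mul_neg, ← ih]
    have e3 : 3 + 2 * (k + 1) = 2 + (3 + 2 * k) := by ring
    rw [e3, pow_add z 2 (3 + 2 * k), pow_add y 2 (3 + 2 * k)]
    have hZ : z ^ (3 + 2 * k) ≠ 0 := pow_ne_zero _ hz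
    generalize z ^ (3 + 2 * k) = Z at *
    have hY : y ^ (3 + 2 * k) ≠ 0 := pow_ne_zero _ hy
    generalize y ^ (3 + 2 * k) = Y at *
    field_simp
    ring

section K
variable {a b s nbar : ℝ} {r : ℝ → ℝ} {z : ℂ}

/-- `K̂ f (z) = v`, with integrability. -/
def KHas (a b s nbar : ℝ) (r : ℝ → ℝ) (z : ℂ) (f : ℂ → ℂ) (v : ℂ) : Prop :=
  IntervalIntegrable (fun y : ℝ => (r y : ℂ) * (f z - f (y : ℂ)) / (z ^ 2 - (y : ℂ) ^ 2))
    volume a b ∧ Khat a b s nbar r f z = v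

lemma KHas.add {f g : ℂ → ℂ} {v w : ℂ} (hf : KHas a b s nbar r z f v)
    (hg : KHas a b s nbar r z g w) : KHas a b s nbar r z (fun x => f x + g x) (v + w) := by
  have e : (fun y : ℝ => (r y : ℂ) * (f z + g z - (f (y : ℂ) + g y)) / (z ^ 2 - (y : ℂ) ^ 2))
    = fun y : ℝ => (r y : ℂ) * (f z - f (y : ℂ)) / (z ^ 2 - (y : ℂ) ^ 2)
      + (r y : ℂ) * (g z - g (y : ℂ)) / (z ^ 2 - (y : ℂ) ^ 2) := by
    ext y; ring
  refine ⟨?_, ?_⟩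
  · simp only [e]; exact hf.1.add hg.1
  · rw [← hf.2, ← hg.2]
    unfold Khat
    simp only [e]
    rw [intervalIntegral.integral_add hf.1 hg.1]
    ring

lemma KHas.const_mul {f : ℂ → ℂ} {v : ℂ} (c : ℂ) (hf : KHas a b s nbar r z f v) :
    KHas a b s nbar r z (fun x => c * f x) (c * v) := by
  have e : (fun y : ℝ => (r y : ℂ) * (c * f z - c * f (y : ℂ)) / (z ^ 2 - (y : ℂ) ^ 2))
    = fun y : ℝ => c * ((r y : ℂ) * (f z - f (y : ℂ)) / (z ^ 2 - (y : ℂ) ^ 2)) := by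
    ext y; ring
  refine ⟨?_, ?_⟩
  · simp only [e]; exact hf.1.const_mul c
  · rw [← hf.2]
    unfold Khat
    simp only [e]
    rw [intervalIntegral.integral_const_mul]
    ring

lemma KHas.zero : KHas a b s nbar r z (fun _ => 0) 0 := by
  constructor <;> simp [Khat]

lemma KHas.sum {ι : Type} (S : Finset ι) {f : ι → ℂ → ℂ} {v : ι → ℂ}
    (hf : ∀ k ∈ S, KHas a b s nbar r z (f k) (v k)) :
    KHas a b s nbar r z (fun x => ∑ k ∈ S, f k x) (∑ k ∈ S, v k) := by
  classical
  induction S using Finset.induction_on with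
  | empty => simpa using KHas.zero
  | insert i S hi ih =>
    simp only [Finset.sum_insert hi]
    exact (hf i (by simp)).add (ih fun k hk => hf k (by simp [hk]))

lemma KHas.pow (ha : 0 < a) (hab : a < b) (hr : ContinuousOn r (Set.Icc a b))
    (hz : Admissible a b z) (k : ℕ) :
    KHas a b s nbar r z (fun w => 1 / w ^ (3 + 2 * k)) (kap k (moment a b s r) z) := by
  have hu : Set.uIcc a b = Set.Icc a b := Set.uIcc_of_le hab.le
  have hy0 : ∀ y ∈ Set.Icc a b, (y : ℂ) ≠ 0 := fun y hy => by
    exact_mod_cast (lt_of_lt_of_le ha hy.1).ne'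
  have hp : ∀ y ∈ Set.Icc a b, z + (y : ℂ) ≠ 0 := fun y hy h =>
    (hz.2 y hy).2 (eq_neg_of_add_eq_zero_left h)
  have hm : ∀ y ∈ Set.Icc a b, z ^ 2 - (y : ℂ) ^ 2 ≠ 0 := fun y hy h => by
    have : (z + y) * (z - y) = 0 := by linear_combination h
    rcases mul_eq_zero.1 this with h | h
    · exact hp y hy h
    · exact (hz.2 y hy).1 (sub_eq_zero.1 h)
  have hrc : ContinuousOn (fun y : ℝ => (r y : ℂ)) (Set.Icc a b) :=
    Complex.continuous_ofReal.comp_continuousOn hr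
  have hyc : ContinuousOn (fun y : ℝ => (y : ℂ)) (Set.Icc a b) :=
    Complex.continuous_ofReal.continuousOn
  have i1 : IntervalIntegrable (fun y : ℝ => (r y : ℂ) / ((z + (y : ℂ)) * (y : ℂ))) volume a b := by
    apply ContinuousOn.intervalIntegrable
    rw [hu]
    exact hrc.div ((continuousOn_const.add hyc).mul hyc)
      fun y hy => mul_ne_zero (hp y hy) (hy0 y hy)
  have i2 : IntervalIntegrable (fun y : ℝ => (r y : ℂ) *
      (1 / z ^ (3 + 2 * k) - 1 / (y : ℂ) ^ (3 + 2 * k)) / (z ^ 2 - (y : ℂ) ^ 2)) volume a b := by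
    apply ContinuousOn.intervalIntegrable
    rw [hu]
    refine (hrc.mul (continuousOn_const.sub (continuousOn_const.div (hyc.pow _) ?_))).div
      (continuousOn_const.sub (hyc.pow _)) hm
    exact fun y hy => pow_ne_zero _ (hy0 y hy)
  have i3 : ∀ j : ℕ, IntervalIntegrable (fun y : ℝ => ((r y / y ^ (3 + 2 * j) : ℝ) : ℂ))
      volume a b := by
    intro j
    apply ContinuousOn.intervalIntegrable
    rw [hu]
    refine Complex.continuous_ofReal.comp_continuousOn (hr.div (continuousOn_id.pow _) ?_)
    exact fun y hy => pow_ne_zero _ (lt_of_lt_of_le ha hy.1).ne'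
  refine ⟨i2, ?_⟩
  have main : 1 / z ^ (3 + 2 * k) * (∫ y in a..b, (r y : ℂ) / ((z + (y : ℂ)) * (y : ℂ)))
      + (∫ y in a..b, (r y : ℂ) *
      (1 / z ^ (3 + 2 * k) - 1 / (y : ℂ) ^ (3 + 2 * k)) / (z ^ 2 - (y : ℂ) ^ 2))
      = - ∑ j ∈ Finset.range (k + 1), ((∫ y in a..b, r y / y ^ (3 + 2 * j) : ℝ) : ℂ)
          * (1 / z ^ (2 + 2 * k - 2 * j)) := by
    rw [← intervalIntegral.integral_const_mul, ← intervalIntegral.integral_add (i1.const_mul _) i2]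
    simp only [← intervalIntegral.integral_ofReal, ← intervalIntegral.integral_mul_const]
    rw [← intervalIntegral.integral_finsetSum (fun j _ => (i3 j).mul_const _),
      ← intervalIntegral.integral_neg]
    refine intervalIntegral.integral_congr fun y hy => ?_
    rw [hu] at hy
    have := kap_point z y hz.1 (hy0 y hy) (hp y hy) (hm y hy) k
    have e : ∑ j ∈ Finset.range (k + 1), ((r y / y ^ (3 + 2 * j) : ℝ) : ℂ)
          * (1 / z ^ (2 + 2 * k - 2 * j)) = (r y : ℂ) * ∑ j ∈ Finset.range (k + 1),
          1 / (y : ℂ) ^ (3 + 2 * j) * (1 / z ^ (2 + 2 * k - 2 * j)) := by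
      rw [Finset.mul_sum]
      refine Finset.sum_congr rfl fun j _ => ?_
      push_cast
      ring
    simp only [e]
    rw [← mul_neg, ← this]
    ring
  have hk : kap k (moment a b s r) z = s * (1 / z ^ (2 + 2 * k))
      - 1 / 2 * ∑ j ∈ Finset.range (k + 1), ((∫ y in a..b, r y / y ^ (3 + 2 * j) : ℝ) : ℂ)
          * (1 / z ^ (2 + 2 * k - 2 * j)) := by
    unfold kap moment
    have : ∀ j : ℕ, (((if j = 0 then s else 0) - (1 / 2) * ∫ y in a..b, r y / y ^ (3 + 2 * j) : ℝ) : ℂ)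
        * (1 / z ^ (2 + 2 * k - 2 * j)) = (if j = 0 then (s : ℂ) * (1 / z ^ (2 + 2 * k)) else 0)
        - 1 / 2 * (((∫ y in a..b, r y / y ^ (3 + 2 * j) : ℝ) : ℂ)
          * (1 / z ^ (2 + 2 * k - 2 * j))) := by
      intro j
      by_cases hj : j = 0
      · subst hj; simp only [if_true]; push_cast; simp only [Nat.sub_zero]; ring
      · simp only [hj, if_false]; push_cast; ring
    simp only [this, Finset.sum_sub_distrib, ← Finset.mul_sum]
    simp
  rw [hk]
  unfold Khat G0fun
  have hzz : z * (1 / z ^ (3 + 2 * k)) = 1 / z ^ (2 + 2 * k) := by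
    have := hz.1
    have e : 3 + 2 * k = 1 + (2 + 2 * k) := by ring
    rw [e, pow_add]
    field_simp
  linear_combination (1 / 2) * main + s * hzz

lemma Khat_congr (hab : a < b) {f g : ℂ → ℂ} (hz : f z = g z)
    (h : ∀ y ∈ Set.Icc a b, f ((y : ℝ) : ℂ) = g y) :
    Khat a b s nbar r f z = Khat a b s nbar r g z := by
  unfold Khat
  rw [hz]
  congr 2
  refine intervalIntegral.integral_congr fun y hy => ?_
  rw [Set.uIcc_of_le hab.le] at hy
  simp only [h y hy]
end K

/-! ### Derivation properties of the boundary creation operator -/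

section adag
variable {N : ℕ} {J : Finset ℕ} {ρ : ℕ → ℝ} {z : ℕ → ℂ} {w : ℂ}

/-- Coefficient of `∂/∂ϱ_l`. -/
def Aco (ρ : ℕ → ℝ) (w : ℂ) (l : ℕ) : ℂ :=
  -((3 + 2 * (l : ℂ)) * (ρ (l + 1) : ℂ)) / ((ρ 0 : ℂ) * w ^ 3)
      + (3 + 2 * (l : ℂ)) / w ^ (5 + 2 * l)

lemma AdagFree_eq {F : (ℕ → ℝ) → (ℕ → ℂ) → ℂ}
    (h : ∀ l, N ≤ l → pdC (fun σ => F σ z) l ρ = 0) :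
    AdagFree J F ρ z w = (∑ l ∈ Finset.range N, Aco ρ w l * pdC (fun σ => F σ z) l ρ)
      + ∑ i ∈ J, (1 / ((ρ 0 : ℂ) * w ^ 3 * z i)) *
      deriv (fun v => F ρ (Function.update z i v)) (z i) := by
  unfold AdagFree
  congr 1
  refine tsum_eq_sum fun l hl => ?_
  rw [h l (by simpa using hl), mul_zero]

lemma Nice_s17.mono {N' : ℕ} {f : (ℕ → ℝ) → (ℕ → ℂ) → ℂ} (hf : Nice_s17 N J ρ z f) (h : N ≤ N') :
    Nice_s17 N' J ρ z f := ⟨hf.dσ, fun l hl => hf.v l (h.trans hl), hf.dz⟩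

lemma Nice_s17.insert {i1 : ℕ} {f : (ℕ → ℝ) → (ℕ → ℂ) → ℂ} (hf : Nice_s17 N J ρ z f)
    (h : ∀ v, f ρ (Function.update z i1 v) = f ρ z) : Nice_s17 N (insert i1 J) ρ z f := by
  refine ⟨hf.dσ, hf.v, fun i hi => ?_⟩
  rcases Finset.mem_insert.1 hi with rfl | hi
  · simp only [h]; exact differentiableAt_const _
  · exact hf.dz i hi

lemma Nice_s17.const (c : ℂ) : Nice_s17 N J ρ z (fun _ _ => c) :=
  ⟨fun _ => differentiableAt_const _, fun _ _ => by simp [pdC], fun _ _ => differentiableAt_const _⟩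

lemma pdC_mul {f g : (ℕ → ℝ) → (ℕ → ℂ) → ℂ} (hf : Nice_s17 N J ρ z f) (hg : Nice_s17 N J ρ z g) (l : ℕ) :
    pdC (fun σ => f σ z * g σ z) l ρ
      = pdC (fun σ => f σ z) l ρ * g ρ z + f ρ z * pdC (fun σ => g σ z) l ρ := by
  unfold pdC
  have := ((hf.dσ l).hasDerivAt.mul (hg.dσ l).hasDerivAt).deriv
  simp only [Function.update_eq_self] at this
  exact this

lemma pdz_mul {f g : (ℕ → ℝ) → (ℕ → ℂ) → ℂ} (hf : Nice_s17 N J ρ z f) (hg : Nice_s17 N J ρ z g)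
    {i : ℕ} (hi : i ∈ J) :
    deriv (fun v => f ρ (Function.update z i v) * g ρ (Function.update z i v)) (z i)
      = deriv (fun v => f ρ (Function.update z i v)) (z i) * g ρ z
        + f ρ z * deriv (fun v => g ρ (Function.update z i v)) (z i) := by
  have := ((hf.dz i hi).hasDerivAt.mul (hg.dz i hi).hasDerivAt).deriv
  simp only [Function.update_eq_self] at this
  exact this

lemma Nice_s17.mul {f g : (ℕ → ℝ) → (ℕ → ℂ) → ℂ} (hf : Nice_s17 N J ρ z f) (hg : Nice_s17 N J ρ z g) :
    Nice_s17 N J ρ z (fun σ τ => f σ τ * g σ τ) := by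
  refine ⟨fun l => (hf.dσ l).mul (hg.dσ l), fun l hl => ?_, fun i hi => (hf.dz i hi).mul (hg.dz i hi)⟩
  rw [pdC_mul hf hg, hf.v l hl, hg.v l hl]
  ring

lemma pdC_add_s17 {f g : (ℕ → ℝ) → (ℕ → ℂ) → ℂ} (hf : Nice_s17 N J ρ z f) (hg : Nice_s17 N J ρ z g) (l : ℕ) :
    pdC (fun σ => f σ z + g σ z) l ρ
      = pdC (fun σ => f σ z) l ρ + pdC (fun σ => g σ z) l ρ :=
  ((hf.dσ l).hasDerivAt.add (hg.dσ l).hasDerivAt).deriv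

lemma Nice_s17.add {f g : (ℕ → ℝ) → (ℕ → ℂ) → ℂ} (hf : Nice_s17 N J ρ z f) (hg : Nice_s17 N J ρ z g) :
    Nice_s17 N J ρ z (fun σ τ => f σ τ + g σ τ) := by
  refine ⟨fun l => (hf.dσ l).add (hg.dσ l), fun l hl => ?_, fun i hi => (hf.dz i hi).add (hg.dz i hi)⟩
  rw [pdC_add_s17 hf hg, hf.v l hl, hg.v l hl]
  ring

lemma Nice_s17.sum {ι : Type} (S : Finset ι) {f : ι → (ℕ → ℝ) → (ℕ → ℂ) → ℂ}
    (hf : ∀ k ∈ S, Nice_s17 N J ρ z (f k)) : Nice_s17 N J ρ z (fun σ τ => ∑ k ∈ S, f k σ τ) := by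
  classical
  induction S using Finset.induction_on with
  | empty => simpa using Nice_s17.const 0
  | insert i S hi ih =>
    simp only [Finset.sum_insert hi]
    exact (hf i (by simp)).add (ih fun k hk => hf k (by simp [hk]))

lemma AdagFree_add {f g : (ℕ → ℝ) → (ℕ → ℂ) → ℂ} (hf : Nice_s17 N J ρ z f) (hg : Nice_s17 N J ρ z g) :
    AdagFree J (fun σ τ => f σ τ + g σ τ) ρ z w = AdagFree J f ρ z w + AdagFree J g ρ z w := by
  rw [AdagFree_eq hf.v, AdagFree_eq hg.v, AdagFree_eq (hf.add hg).v]
  simp only [pdC_add_s17 hf hg, mul_add, Finset.sum_add_distrib]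
  have : ∀ i ∈ J, (1 / ((ρ 0 : ℂ) * w ^ 3 * z i)) *
      deriv (fun v => f ρ (Function.update z i v) + g ρ (Function.update z i v)) (z i)
      = (1 / ((ρ 0 : ℂ) * w ^ 3 * z i)) * deriv (fun v => f ρ (Function.update z i v)) (z i)
      + (1 / ((ρ 0 : ℂ) * w ^ 3 * z i)) * deriv (fun v => g ρ (Function.update z i v)) (z i) := by
    intro i hi
    rw [← mul_add]
    congr 1
    exact ((hf.dz i hi).hasDerivAt.add (hg.dz i hi).hasDerivAt).deriv
  rw [Finset.sum_congr rfl this, Finset.sum_add_distrib]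
  ring

lemma AdagFree_mul {f g : (ℕ → ℝ) → (ℕ → ℂ) → ℂ} (hf : Nice_s17 N J ρ z f) (hg : Nice_s17 N J ρ z g) :
    AdagFree J (fun σ τ => f σ τ * g σ τ) ρ z w
      = AdagFree J f ρ z w * g ρ z + f ρ z * AdagFree J g ρ z w := by
  rw [AdagFree_eq hf.v, AdagFree_eq hg.v, AdagFree_eq (hf.mul hg).v]
  have e1 : ∀ i ∈ J, (1 / ((ρ 0 : ℂ) * w ^ 3 * z i)) *
      deriv (fun v => f ρ (Function.update z i v) * g ρ (Function.update z i v)) (z i)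
      = (1 / ((ρ 0 : ℂ) * w ^ 3 * z i)) * deriv (fun v => f ρ (Function.update z i v)) (z i) * g ρ z
      + f ρ z * ((1 / ((ρ 0 : ℂ) * w ^ 3 * z i)) *
        deriv (fun v => g ρ (Function.update z i v)) (z i)) := by
    intro i hi
    rw [pdz_mul hf hg hi]
    ring
  have e2 : ∀ l ∈ Finset.range N, Aco ρ w l * pdC (fun σ => f σ z * g σ z) l ρ
      = Aco ρ w l * pdC (fun σ => f σ z) l ρ * g ρ z
        + f ρ z * (Aco ρ w l * pdC (fun σ => g σ z) l ρ) := by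
    intro l _
    rw [pdC_mul hf hg]
    ring
  rw [Finset.sum_congr rfl e1, Finset.sum_congr rfl e2, Finset.sum_add_distrib,
    Finset.sum_add_distrib, ← Finset.sum_mul, ← Finset.mul_sum, ← Finset.sum_mul, ← Finset.mul_sum]
  ring

lemma AdagFree_const (c : ℂ) : AdagFree J (fun _ _ => c) ρ z w = 0 := by
  simp [AdagFree, pdC]

lemma AdagFree_const_mul {f : (ℕ → ℝ) → (ℕ → ℂ) → ℂ} (c : ℂ) (hf : Nice_s17 N J ρ z f) :
    AdagFree J (fun σ τ => c * f σ τ) ρ z w = c * AdagFree J f ρ z w := by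
  rw [AdagFree_mul (Nice_s17.const c) hf, AdagFree_const]
  ring

lemma AdagFree_sum {ι : Type} (S : Finset ι) {f : ι → (ℕ → ℝ) → (ℕ → ℂ) → ℂ}
    (hf : ∀ k ∈ S, Nice_s17 N J ρ z (f k)) :
    AdagFree J (fun σ τ => ∑ k ∈ S, f k σ τ) ρ z w = ∑ k ∈ S, AdagFree J (f k) ρ z w := by
  classical
  induction S using Finset.induction_on with
  | empty => simpa using AdagFree_const 0
  | insert i S hi ih =>
    simp only [Finset.sum_insert hi]
    have hS : ∀ k ∈ S, Nice_s17 N J ρ z (f k) := fun k hk => hf k (by simp [hk])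
    rw [AdagFree_add (hf i (by simp)) (Nice_s17.sum S hS), ih hS]

lemma AdagFree_congr {I : Finset ℕ} {f g : (ℕ → ℝ) → (ℕ → ℂ) → ℂ} (h0 : ρ 0 ≠ 0)
    (hI : ∀ i ∈ I, z i ≠ 0)
    (h : ∀ σ τ, σ 0 ≠ 0 → (∀ i ∈ I, τ i ≠ 0) → f σ τ = g σ τ) :
    AdagFree J f ρ z w = AdagFree J g ρ z w := by
  have e1 : ∀ l, pdC (fun σ => f σ z) l ρ = pdC (fun σ => g σ z) l ρ := by
    intro l
    refine Filter.EventuallyEq.deriv_eq ?_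
    filter_upwards [ev_upd ρ h0 l] with t ht using h _ _ ht hI
  have e2 : ∀ i, deriv (fun v => f ρ (Function.update z i v)) (z i)
      = deriv (fun v => g ρ (Function.update z i v)) (z i) := by
    intro i
    refine Filter.EventuallyEq.deriv_eq ?_
    filter_upwards [ev_updz z I hI i] with t ht using h _ _ h0 ht
  unfold AdagFree
  simp only [e1, e2]

/-! Basic functions -/

lemma hasDerivAt_coord (ρ : ℕ → ℝ) (j l : ℕ) :
    HasDerivAt (fun t : ℝ => ((Function.update ρ l t j : ℝ) : ℂ)) (if j = l then 1 else 0) (ρ l) := by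
  by_cases h : j = l
  · subst h
    simp only [Function.update_self, if_true]
    exact Complex.ofRealCLM.hasDerivAt
  · simp only [Function.update_of_ne h, h, if_false]
    exact hasDerivAt_const _ _

lemma Nice_s17.coord {j : ℕ} (hj : j < N) : Nice_s17 N J ρ z (fun σ _ => (σ j : ℂ)) := by
  refine ⟨fun l => (hasDerivAt_coord ρ j l).differentiableAt, fun l hl => ?_,
    fun _ _ => differentiableAt_const _⟩
  have := (hasDerivAt_coord ρ j l).deriv
  rw [if_neg (by omega)] at this
  exact this

lemma AdagFree_coord (j : ℕ) : AdagFree J (fun σ _ => (σ j : ℂ)) ρ z w = Aco ρ w j := by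
  rw [AdagFree_eq (Nice_s17.coord (J := J) (z := z) (Nat.lt_succ_self j)).v]
  have : ∀ l, pdC (fun σ => (σ j : ℂ)) l ρ = if j = l then 1 else 0 :=
    fun l => (hasDerivAt_coord ρ j l).deriv
  simp [this]

lemma Nice_s17.inv0 (h0 : ρ 0 ≠ 0) (hN : 0 < N) : Nice_s17 N J ρ z (fun σ _ => (σ 0 : ℂ)⁻¹) := by
  have h : ∀ l, HasDerivAt (fun t : ℝ => ((Function.update ρ l t 0 : ℝ) : ℂ)⁻¹)
      (-(if 0 = l then 1 else 0) / ((Function.update ρ l (ρ l) 0 : ℝ) : ℂ) ^ 2) (ρ l) := by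
    intro l
    refine (hasDerivAt_coord ρ 0 l).inv ?_
    simpa using h0
  refine ⟨fun l => (h l).differentiableAt, fun l hl => ?_, fun _ _ => differentiableAt_const _⟩
  have := (h l).deriv
  rw [if_neg (by omega), neg_zero, zero_div] at this
  exact this

lemma hasDerivAt_invpow {x : ℂ} (hx : x ≠ 0) (n : ℕ) :
    HasDerivAt (fun v : ℂ => 1 / v ^ n) (-(n : ℂ) / x ^ (n + 1)) x := by
  have := (hasDerivAt_pow n x).inv (pow_ne_zero n hx)
  simp only [one_div]
  refine this.congr_deriv ?_
  rcases n with _ | n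
  · simp
  · have : (n + 1 - 1 : ℕ) = n := rfl
    rw [this]
    field_simp
    ring

lemma Nice_s17.invpow {i : ℕ} (n : ℕ) (hz : z i ≠ 0) : Nice_s17 N J ρ z (fun _ τ => 1 / (τ i) ^ n) := by
  refine ⟨fun _ => differentiableAt_const _, fun _ _ => by simp [pdC], fun j _ => ?_⟩
  by_cases h : i = j
  · subst h
    simp only [Function.update_self]
    exact (hasDerivAt_invpow hz n).differentiableAt
  · simp only [Function.update_of_ne h]
    exact differentiableAt_const _

lemma AdagFree_invpow {i : ℕ} (hi : i ∈ J) (n : ℕ) (hz : z i ≠ 0) :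
    AdagFree J (fun _ τ => 1 / (τ i) ^ n) ρ z w
      = 1 / ((ρ 0 : ℂ) * w ^ 3 * z i) * (-(n : ℂ) / (z i) ^ (n + 1)) := by
  rw [AdagFree_eq (N := 0) (by simp [pdC])]
  simp only [Finset.range_zero, Finset.sum_empty, zero_add]
  rw [Finset.sum_eq_single_of_mem i hi]
  · simp only [Function.update_self]
    rw [(hasDerivAt_invpow hz n).deriv]
  · intro j _ hj
    simp only [Function.update_of_ne (Ne.symm hj)]
    simp

end adag

/-! ### The expansion coefficients of `Φ` -/

/-- Coefficient of `z₁^{-3-2k}` in `Â†_{z_I,z₁} F`. -/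
def phi (M : ℕ) (I : Finset ℕ) (F : (ℕ → ℝ) → (ℕ → ℂ) → ℂ) (k : ℕ) (σ : ℕ → ℝ) (τ : ℕ → ℂ) : ℂ :=
  match k with
  | 0 => (∑ l ∈ Finset.range (M + 1), (-(3 + 2 * (l : ℂ))) *
          ((σ (l + 1) : ℂ) * ((σ 0 : ℂ)⁻¹ * pdC (fun σ' => F σ' τ) l σ)))
        + ∑ i ∈ I, (σ 0 : ℂ)⁻¹ * (1 / τ i ^ 1 * deriv (fun v => F σ (Function.update τ i v)) (τ i))
  | k + 1 => (3 + 2 * (k : ℂ)) * pdC (fun σ' => F σ' τ) k σ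

section main
variable {M : ℕ} {I : Finset ℕ} {F : (ℕ → ℝ) → (ℕ → ℂ) → ℂ} {ρ : ℕ → ℝ} {z : ℕ → ℂ} {w : ℂ}
  {i1 : ℕ}

lemma phi_nice (hF : SmoothFam M I F) (h0 : ρ 0 ≠ 0) (hI : ∀ i ∈ I, z i ≠ 0) (k : ℕ) :
    Nice_s17 (M + 2) I ρ z (phi M I F k) := by
  obtain ⟨n1, n2, -, -⟩ := hF.nice h0 hI
  have hM : M + 1 ≤ M + 2 := by omega
  cases k with
  | zero =>
    unfold phi
    refine Nice_s17.add (Nice_s17.sum _ fun l hl => ?_) (Nice_s17.sum _ fun i hi => ?_)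
    · refine (Nice_s17.const _).mul (Nice_s17.mul (Nice_s17.coord ?_) (Nice_s17.mul (Nice_s17.inv0 h0 (by omega)) ?_))
      · have := Finset.mem_range.1 hl; omega
      · exact (n1 l).mono hM
    · exact (Nice_s17.inv0 h0 (by omega)).mul (Nice_s17.mul (Nice_s17.invpow 1 (hI i hi)) ((n2 i hi).mono hM))
  | succ k =>
    unfold phi
    exact (Nice_s17.const _).mul ((n1 k).mono hM)

lemma F_upd (hF : SmoothFam M I F) (σ : ℕ → ℝ) (τ : ℕ → ℂ) (j : ℕ) (v : ℂ) (hj : j ∉ I) :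
    F σ (Function.update τ j v) = F σ τ :=
  (hF.nice (ρ := fun _ => 1) (z := fun _ => 1) one_ne_zero fun _ _ => one_ne_zero).2.2.2 σ τ j v hj

lemma phi_upd (hF : SmoothFam M I F) (σ : ℕ → ℝ) (τ : ℕ → ℂ) (v : ℂ) (hi1 : i1 ∉ I) (k : ℕ) :
    phi M I F k σ (Function.update τ i1 v) = phi M I F k σ τ := by
  have e1 : ∀ l, pdC (fun σ' => F σ' (Function.update τ i1 v)) l σ = pdC (fun σ' => F σ' τ) l σ := by
    intro l; simp only [F_upd hF _ _ _ _ hi1]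
  cases k with
  | zero =>
    unfold phi
    simp only [e1]
    congr 1
    refine Finset.sum_congr rfl fun i hi => ?_
    have hne : i ≠ i1 := fun h => hi1 (h ▸ hi)
    simp only [Function.update_of_ne hne, Function.update_comm hne.symm, F_upd hF _ _ _ _ hi1]
  | succ k =>
    unfold phi
    simp only [e1]

lemma Ad_phi_upd (hF : SmoothFam M I F) (v : ℂ) (hi1 : i1 ∉ I) (k : ℕ) :
    AdagFree I (phi M I F k) ρ (Function.update z i1 v) w = AdagFree I (phi M I F k) ρ z w := by
  unfold AdagFree
  simp only [phi_upd hF _ _ _ hi1]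
  congr 1
  refine Finset.sum_congr rfl fun i hi => ?_
  have hne : i ≠ i1 := fun h => hi1 (h ▸ hi)
  simp only [Function.update_of_ne hne, Function.update_comm hne.symm, phi_upd hF _ _ _ hi1]

lemma Ad_phi_insert (hF : SmoothFam M I F) (hi1 : i1 ∉ I) (k : ℕ) :
    AdagFree (insert i1 I) (phi M I F k) ρ z w = AdagFree I (phi M I F k) ρ z w := by
  unfold AdagFree
  rw [Finset.sum_insert hi1]
  simp only [phi_upd hF _ _ _ hi1]
  simp

lemma phi_sum (g : ℕ → ℂ) :
    ∑ k ∈ Finset.range (M + 2), phi M I F k ρ z * g k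
    = (∑ l ∈ Finset.range (M + 1), (3 + 2 * (l : ℂ)) * (g (l + 1) - ρ (l + 1) * (ρ 0 : ℂ)⁻¹ * g 0)
        * pdC (fun σ' => F σ' z) l ρ)
      + ∑ i ∈ I, (ρ 0 : ℂ)⁻¹ * (z i)⁻¹ * g 0 *
          deriv (fun v => F ρ (Function.update z i v)) (z i) := by
  rw [Finset.sum_range_succ' _ (M + 1)]
  simp only [phi]
  rw [add_mul, Finset.sum_mul, Finset.sum_mul, ← add_assoc, ← Finset.sum_add_distrib]
  congr 1
  · refine Finset.sum_congr rfl fun l _ => ?_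
    ring
  · refine Finset.sum_congr rfl fun l _ => ?_
    rw [pow_one, one_div]
    ring

lemma Phi_eq (hF : SmoothFam M I F) (h0 : ρ 0 ≠ 0) (hI : ∀ i ∈ I, z i ≠ 0) :
    AdagFree I F ρ z (z i1) =
      ∑ k ∈ Finset.range (M + 2), phi M I F k ρ z * (1 / (z i1) ^ (3 + 2 * k)) := by
  rw [AdagFree_eq ((hF.nice h0 hI).2.2.1 ρ z h0 hI), phi_sum]
  congr 1
  · refine Finset.sum_congr rfl fun l _ => ?_
    have : 3 + 2 * (l + 1) = 5 + 2 * l := by ring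
    rw [this]
    unfold Aco
    simp only [div_eq_mul_inv, mul_inv]
    ring
  · refine Finset.sum_congr rfl fun i _ => ?_
    simp only [one_div, mul_inv]
    ring

lemma E_eq (h0 : ρ 0 ≠ 0) (x : ℂ) :
    (1 / x ^ 2) *
        ((∑ l ∈ Finset.range (M + 1), (3 + 2 * (l : ℂ)) * pdC (fun τ => F τ z) l ρ *
            ∑ k ∈ Finset.range (l + 1), (ρ k : ℂ) / x ^ (2 + 2 * l - 2 * k))
         + ∑ β ∈ I, (1 / z β) * deriv (fun v => F ρ (Function.update z β v)) (z β))
    = ∑ k ∈ Finset.range (M + 2), phi M I F k ρ z * kap k ρ x := by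
  have h0' : (ρ 0 : ℂ) ≠ 0 := by exact_mod_cast h0
  have ek : ∀ l : ℕ, kap (l + 1) ρ x = 1 / x ^ 2 * (∑ k ∈ Finset.range (l + 1),
      (ρ k : ℂ) / x ^ (2 + 2 * l - 2 * k)) + ρ (l + 1) * (1 / x ^ 2) := by
    intro l
    unfold kap
    rw [Finset.sum_range_succ, Finset.mul_sum]
    congr 1
    · refine Finset.sum_congr rfl fun j hj => ?_
      have hj' : j ≤ l := by simpa [Nat.lt_succ_iff] using hj
      have : 2 + 2 * (l + 1) - 2 * j = 2 + (2 + 2 * l - 2 * j) := by omega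
      rw [this, pow_add x 2]
      ring
    · have : 2 + 2 * (l + 1) - 2 * (l + 1) = 2 := by omega
      rw [this]
  have ek0 : kap 0 ρ x = ρ 0 * (1 / x ^ 2) := by simp [kap]
  rw [phi_sum, mul_add, Finset.mul_sum, Finset.mul_sum]
  congr 1
  · refine Finset.sum_congr rfl fun l _ => ?_
    rw [ek, ek0]
    have : (ρ 0 : ℂ)⁻¹ * ρ 0 = 1 := inv_mul_cancel₀ h0'
    linear_combination (-(3 + 2 * (l : ℂ)) * -(ρ (l + 1)) * (1 / x ^ 2)
      * pdC (fun τ => F τ z) l ρ) * this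
  · refine Finset.sum_congr rfl fun l _ => ?_
    rw [ek0]
    field_simp

/-- Leibniz rule on expansions. -/
lemma Ad_expand (hF : SmoothFam M I F) (h0 : ρ 0 ≠ 0) (hI : ∀ i ∈ I, z i ≠ 0) (hi1 : i1 ∉ I)
    (c : ℂ) {h : ℕ → (ℕ → ℝ) → (ℕ → ℂ) → ℂ}
    (hh : ∀ k < M + 2, Nice_s17 (M + 2) (insert i1 I) ρ z (h k)) :
    AdagFree (insert i1 I) (fun σ τ => c * ∑ k ∈ Finset.range (M + 2), phi M I F k σ τ * h k σ τ) ρ z w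
    = c * ∑ k ∈ Finset.range (M + 2), (AdagFree I (phi M I F k) ρ z w * h k ρ z
        + phi M I F k ρ z * AdagFree (insert i1 I) (h k) ρ z w) := by
  have hp : ∀ k, Nice_s17 (M + 2) (insert i1 I) ρ z (phi M I F k) := fun k =>
    (phi_nice hF h0 hI k).insert fun v => phi_upd hF _ _ _ hi1 k
  have hs : ∀ k ∈ Finset.range (M + 2), Nice_s17 (M + 2) (insert i1 I) ρ z
      (fun σ τ => phi M I F k σ τ * h k σ τ) := fun k hk =>
    (hp k).mul (hh k (Finset.mem_range.1 hk))
  rw [AdagFree_const_mul c (Nice_s17.sum _ hs), AdagFree_sum _ hs]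
  congr 1
  refine Finset.sum_congr rfl fun k hk => ?_
  rw [AdagFree_mul (hp k) (hh k (Finset.mem_range.1 hk)), Ad_phi_insert hF hi1]

lemma kap_nice (hz : z i1 ≠ 0) {k : ℕ} (hk : k < M + 2) (J : Finset ℕ) :
    Nice_s17 (M + 2) J ρ z (fun σ τ => kap k σ (τ i1)) := by
  unfold kap
  refine Nice_s17.sum _ fun j hj => (Nice_s17.coord ?_).mul (Nice_s17.invpow _ hz)
  have := Finset.mem_range.1 hj
  omega

lemma Ad_kap (hz : z i1 ≠ 0) (k : ℕ) {J : Finset ℕ} (hJ : i1 ∈ J) :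
    AdagFree J (fun σ τ => kap k σ (τ i1)) ρ z w
    = ∑ j ∈ Finset.range (k + 1), (Aco ρ w j * (1 / z i1 ^ (2 + 2 * k - 2 * j))
      + ρ j * (1 / ((ρ 0 : ℂ) * w ^ 3 * z i1) *
        (-((2 + 2 * k - 2 * j : ℕ) : ℂ) / (z i1) ^ (2 + 2 * k - 2 * j + 1)))) := by
  unfold kap
  have hc : ∀ j ∈ Finset.range (k + 1), Nice_s17 (k + 1) J ρ z (fun σ _ => (σ j : ℂ)) := fun j hj =>
    Nice_s17.coord (Finset.mem_range.1 hj)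
  rw [AdagFree_sum (N := k + 1) _ fun j hj => (hc j hj).mul (Nice_s17.invpow _ hz)]
  refine Finset.sum_congr rfl fun j hj => ?_
  rw [AdagFree_mul (hc j hj) (Nice_s17.invpow _ hz), AdagFree_coord, AdagFree_invpow hJ _ hz]

lemma tele (k : ℕ) (p : ℕ → ℂ) :
    -(3 + 2 * (k : ℂ)) * ∑ j ∈ Finset.range (k + 2), p j
      + ∑ j ∈ Finset.range (k + 1), (3 + 2 * (j : ℂ)) * p (j + 1)
      + ∑ j ∈ Finset.range (k + 1), (2 + 2 * (k : ℂ) - 2 * j) * p j = - p 0 := by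
  have e1 : ∑ j ∈ Finset.range (k + 1), (3 + 2 * (j : ℂ)) * p (j + 1)
      = ∑ j ∈ Finset.range (k + 2), (1 + 2 * (j : ℂ)) * p j - p 0 := by
    rw [Finset.sum_range_succ' _ (k + 1)]
    simp only [Nat.cast_zero, mul_zero, add_zero, one_mul, add_sub_cancel_right]
    refine Finset.sum_congr rfl fun j _ => ?_
    push_cast
    ring
  have e2 : ∑ j ∈ Finset.range (k + 1), (2 + 2 * (k : ℂ) - 2 * j) * p j
      = ∑ j ∈ Finset.range (k + 2), (2 + 2 * (k : ℂ) - 2 * j) * p j := by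
    rw [Finset.sum_range_succ _ (k + 1)]
    push_cast
    ring
  have e3 : -(3 + 2 * (k : ℂ)) * ∑ j ∈ Finset.range (k + 2), p j
      + ∑ j ∈ Finset.range (k + 2), (1 + 2 * (j : ℂ)) * p j
      + ∑ j ∈ Finset.range (k + 2), (2 + 2 * (k : ℂ) - 2 * j) * p j = 0 := by
    rw [Finset.mul_sum, ← Finset.sum_add_distrib, ← Finset.sum_add_distrib]
    refine Finset.sum_eq_zero fun j _ => ?_
    ring
  rw [e1, e2]
  linear_combination e3

lemma core (h0 : ρ 0 ≠ 0) (hz : z i1 ≠ 0) (k : ℕ) {J : Finset ℕ} (hJ : i1 ∈ J) :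
    -(3 + 2 * (k : ℂ)) / (ρ 0 * w ^ 3) * kap (k + 1) ρ (z i1)
      - AdagFree J (fun σ τ => kap k σ (τ i1)) ρ z w
    = -(1 / (w ^ 3 * z i1 ^ (4 + 2 * k)))
      - ∑ j ∈ Finset.range (k + 1), (3 + 2 * (j : ℂ)) / (w ^ (5 + 2 * j) * z i1 ^ (2 + 2 * k - 2 * j)) := by
  have h0' : (ρ 0 : ℂ) ≠ 0 := by exact_mod_cast h0
  rw [Ad_kap hz k hJ]
  have ht := tele k (fun j => (ρ j : ℂ) * (1 / z i1 ^ (2 + 2 * (k + 1) - 2 * j)))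
  have e1 : ∀ j ∈ Finset.range (k + 1), (Aco ρ w j * (1 / z i1 ^ (2 + 2 * k - 2 * j))
      + ρ j * (1 / ((ρ 0 : ℂ) * w ^ 3 * z i1) *
        (-((2 + 2 * k - 2 * j : ℕ) : ℂ) / (z i1) ^ (2 + 2 * k - 2 * j + 1))))
      = (3 + 2 * (j : ℂ)) / (w ^ (5 + 2 * j) * z i1 ^ (2 + 2 * k - 2 * j))
        - 1 / (ρ 0 * w ^ 3) * ((3 + 2 * (j : ℂ)) *
            ((ρ (j + 1) : ℂ) * (1 / z i1 ^ (2 + 2 * (k + 1) - 2 * (j + 1)))))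
        - 1 / (ρ 0 * w ^ 3) * ((2 + 2 * (k : ℂ) - 2 * j) *
            ((ρ j : ℂ) * (1 / z i1 ^ (2 + 2 * (k + 1) - 2 * j)))) := by
    intro j hj
    have hj' : j ≤ k := by simpa [Nat.lt_succ_iff] using hj
    have a1 : 2 + 2 * (k + 1) - 2 * (j + 1) = 2 + 2 * k - 2 * j := by omega
    have a2 : 2 + 2 * (k + 1) - 2 * j = 2 + 2 * k - 2 * j + 2 := by omega
    have a3 : ((2 + 2 * k - 2 * j : ℕ) : ℂ) = 2 + 2 * (k : ℂ) - 2 * j := by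
      rw [Nat.cast_sub (by omega)]; push_cast; ring
    rw [a1, a2, a3]
    generalize 2 + 2 * k - 2 * j = n
    unfold Aco
    simp only [div_eq_mul_inv, mul_inv, pow_succ, one_mul]
    ring
  rw [Finset.sum_congr rfl e1, Finset.sum_sub_distrib, Finset.sum_sub_distrib, ← Finset.mul_sum,
    ← Finset.mul_sum]
  unfold kap
  have e4 : 1 / ((ρ 0 : ℂ) * w ^ 3) * -((ρ 0 : ℂ) * (1 / z i1 ^ (4 + 2 * k)))
      = -(1 / (w ^ 3 * z i1 ^ (4 + 2 * k))) := by
    simp only [one_div, mul_inv]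
    field_simp
  have e5 : 2 + 2 * (k + 1) - 2 * 0 = 4 + 2 * k := by omega
  rw [e5] at ht
  rw [← e4, ← ht]
  ring

end main

end NCQFT

set_option maxHeartbeats 1000000 in
open NCQFT in
/-- (Lemma 8)  The commutator of `K̂` (acting on the `z₁`-dependence) with
the boundary creation operator `Â†_{z_{I∪{1}},z_B}` applied to `Φ := (2λ)³Â†_{z_I,z₁}F`.
The term `Â†(K̂Φ)` is taken in the formal-moment calculus: `K̂Φ` is represented by its
Lemma-5 value `E(σ,·)` with formal moment variables `σ` (which at `σ = ϱ` equals `K̂Φ`). -/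
theorem stmt17 (a b s nbar : ℝ) (r : ℝ → ℝ)
    (ha : 0 < a) (hab : a < b)
    (hr : ContinuousOn r (Set.Icc a b)) (hrpos : ∀ y ∈ Set.Icc a b, 0 ≤ r y)
    (hs : 0 < s) (hρ0 : moment a b s r 0 ≠ 0)
    (lam : ℝ) (I : Finset ℕ) (i1 iB : ℕ)
    (hi1 : i1 ∉ I) (hiB : iB ∉ I) (h1B : i1 ≠ iB)
    (M : ℕ) (F : (ℕ → ℝ) → (ℕ → ℂ) → ℂ) (hF : SmoothFam M I F)
    (z : ℕ → ℂ) (hz1 : Admissible a b (z i1)) (hzB : z iB ≠ 0)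
    (hzI : ∀ i ∈ I, z i ≠ 0)
    (E : (ℕ → ℝ) → (ℕ → ℂ) → ℂ)
    (hE : ∀ (σ : ℕ → ℝ) (w : ℕ → ℂ), E σ w =
      (8 * (lam : ℂ) ^ 3 / (w i1) ^ 2) *
        ((∑ l ∈ Finset.range (M + 1), (3 + 2 * (l : ℂ)) * pdC (fun τ => F τ w) l σ *
            ∑ k ∈ Finset.range (l + 1), (σ k : ℂ) / (w i1) ^ (2 + 2 * l - 2 * k))
         + ∑ β ∈ I, (1 / w β) *
            deriv (fun v => F σ (Function.update w β v)) (w β))) :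
    (2 * (lam : ℂ)) ^ 3 *
      (Khat a b s nbar r
          (fun w => AdagVar (insert i1 I) iB
              (fun σ τ => (2 * (lam : ℂ)) ^ 3 * AdagFree I F σ τ (τ i1))
              (moment a b s r) (Function.update z i1 w)) (z i1)
        - AdagVar (insert i1 I) iB E (moment a b s r) z)
    = (2 * (lam : ℂ)) ^ 6 *
      ((∑ l ∈ Finset.range (M + 1), ((3 + 2 * (l : ℂ)) / ((z i1) ^ 2 * (z iB) ^ 3)) *
          ((moment a b s r (l + 1) : ℂ) / ((moment a b s r 0 : ℂ) * (z i1) ^ 2)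
            + 3 * (moment a b s r (l + 1) : ℂ) / ((moment a b s r 0 : ℂ) * (z iB) ^ 2)
            - 1 / (z i1) ^ (4 + 2 * l) - (5 + 2 * (l : ℂ)) / (z iB) ^ (4 + 2 * l)) *
          pdC (fun σ => F σ z) l (moment a b s r))
        - (∑ l ∈ Finset.range (M + 1), ∑ k ∈ Finset.range (l + 1),
            (3 + 2 * (l : ℂ)) * (3 + 2 * (k : ℂ)) /
              ((z i1) ^ (4 + 2 * l - 2 * k) * (z iB) ^ (5 + 2 * k)) *
            pdC (fun σ => F σ z) l (moment a b s r))
        - ∑ i ∈ I, (1 / ((moment a b s r 0 : ℂ) * (z i1) ^ 2 * z i * (z iB) ^ 3)) *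
            (1 / (z i1) ^ 2 + 3 / (z iB) ^ 2) *
            deriv (fun v => F (moment a b s r) (Function.update z i v)) (z i)) := by
  have h0 := hρ0
  set ρ := moment a b s r with hρdef
  have hz10 : z i1 ≠ 0 := hz1.1
  have h0' : (ρ 0 : ℂ) ≠ 0 := by exact_mod_cast h0
  set c : ℂ := (2 * (lam : ℂ)) ^ 3 with hc
  -- the expansion of the inner function
  have hf : ∀ w : ℂ, w ≠ 0 →
      AdagVar (insert i1 I) iB (fun σ τ => c * AdagFree I F σ τ (τ i1)) ρ (Function.update z i1 w)
      = c * ∑ k ∈ Finset.range (M + 2), (AdagFree I (phi M I F k) ρ z (z iB) * (1 / w ^ (3 + 2 * k))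
        + (phi M I F k ρ z * (-(3 + 2 * (k : ℂ)) / (ρ 0 * z iB ^ 3)))
            * (1 / w ^ (3 + 2 * (k + 1)))) := by
    intro w hw
    have hI' : ∀ i ∈ I, Function.update z i1 w i ≠ 0 := by
      intro i hi
      have hne : i ≠ i1 := fun h => hi1 (h ▸ hi)
      rw [Function.update_of_ne hne]
      exact hzI i hi
    have hw' : Function.update z i1 w i1 ≠ 0 := by simpa using hw
    unfold AdagVar
    rw [Function.update_of_ne h1B.symm]
    rw [AdagFree_congr (I := I) (g := fun σ τ => c * ∑ k ∈ Finset.range (M + 2),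
      phi M I F k σ τ * (1 / (τ i1) ^ (3 + 2 * k))) h0 hI'
      (fun σ τ hσ hτ => by rw [Phi_eq hF hσ hτ])]
    rw [Ad_expand (h := fun k _ τ => 1 / (τ i1) ^ (3 + 2 * k)) hF h0 hI' hi1 c
      (fun k _ => Nice_s17.invpow _ hw')]
    congr 1
    refine Finset.sum_congr rfl fun k _ => ?_
    rw [AdagFree_invpow (Finset.mem_insert_self _ _) _ hw', Ad_phi_upd hF w hi1,
      phi_upd hF _ _ _ hi1]
    simp only [Function.update_self]
    have e : 3 + 2 * (k + 1) = (3 + 2 * k + 1) + 1 := by ring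
    rw [e, pow_succ w (3 + 2 * k + 1)]
    push_cast
    simp only [div_eq_mul_inv, mul_inv]
    ring
  have hK : Khat a b s nbar r (fun w => AdagVar (insert i1 I) iB
        (fun σ τ => c * AdagFree I F σ τ (τ i1)) ρ (Function.update z i1 w)) (z i1)
      = c * ∑ k ∈ Finset.range (M + 2), (AdagFree I (phi M I F k) ρ z (z iB) * kap k ρ (z i1)
        + (phi M I F k ρ z * (-(3 + 2 * (k : ℂ)) / (ρ 0 * z iB ^ 3))) * kap (k + 1) ρ (z i1)) := by
    have hKH := KHas.const_mul c (KHas.sum (Finset.range (M + 2)) fun k _ =>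
      ((KHas.pow (s := s) (nbar := nbar) ha hab hr hz1 k).const_mul
        (AdagFree I (phi M I F k) ρ z (z iB))).add
      ((KHas.pow (s := s) (nbar := nbar) ha hab hr hz1 (k + 1)).const_mul
        (phi M I F k ρ z * (-(3 + 2 * (k : ℂ)) / (ρ 0 * z iB ^ 3)))))
    refine Eq.trans (Khat_congr hab ?_ ?_) hKH.2
    · exact hf (z i1) hz10
    · intro y hy
      have hy0 : (y : ℂ) ≠ 0 := by exact_mod_cast (lt_of_lt_of_le ha hy.1).ne'
      exact hf (y : ℂ) hy0
  have hEA : AdagVar (insert i1 I) iB E ρ z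
      = c * ∑ k ∈ Finset.range (M + 2), (AdagFree I (phi M I F k) ρ z (z iB) * kap k ρ (z i1)
        + phi M I F k ρ z *
          AdagFree (insert i1 I) (fun σ τ => kap k σ (τ i1)) ρ z (z iB)) := by
    unfold AdagVar
    rw [AdagFree_congr (I := I) (g := fun σ τ => c * ∑ k ∈ Finset.range (M + 2),
      phi M I F k σ τ * kap k σ (τ i1)) h0 hzI
      (fun σ τ hσ hτ => by
        rw [hE, ← E_eq hσ, hc]
        ring)]
    exact Ad_expand (h := fun k σ τ => kap k σ (τ i1)) hF h0 hzI hi1 c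
      (fun k hk => kap_nice hz10 hk _)
  rw [hK, hEA, ← mul_sub, ← Finset.sum_sub_distrib]
  have hd : ∀ k ∈ Finset.range (M + 2),
      (AdagFree I (phi M I F k) ρ z (z iB) * kap k ρ (z i1)
        + (phi M I F k ρ z * (-(3 + 2 * (k : ℂ)) / (ρ 0 * z iB ^ 3))) * kap (k + 1) ρ (z i1))
      - (AdagFree I (phi M I F k) ρ z (z iB) * kap k ρ (z i1)
        + phi M I F k ρ z *
          AdagFree (insert i1 I) (fun σ τ => kap k σ (τ i1)) ρ z (z iB))
      = phi M I F k ρ z * (-(1 / (z iB ^ 3 * z i1 ^ (4 + 2 * k)))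
      - ∑ j ∈ Finset.range (k + 1), (3 + 2 * (j : ℂ)) /
          (z iB ^ (5 + 2 * j) * z i1 ^ (2 + 2 * k - 2 * j))) := by
    intro k _
    rw [← core h0 hz10 k (Finset.mem_insert_self i1 I)]
    ring
  rw [Finset.sum_congr rfl hd, phi_sum, ← mul_assoc]
  have hc6 : c * c = (2 * (lam : ℂ)) ^ 6 := by rw [hc]; ring
  rw [hc6]
  congr 1
  rw [← Finset.sum_sub_distrib]
  refine (congrArg₂ (· + ·) ?_ ?_).trans (sub_eq_add_neg _ _).symm
  · refine Finset.sum_congr rfl fun l _ => ?_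
    rw [Finset.sum_range_succ _ (l + 1)]
    have a1 : 2 + 2 * (l + 1) - 2 * (l + 1) = 2 := by omega
    have a2 : 4 + 2 * (l + 1) = 2 + (4 + 2 * l) := by ring
    have a3 : 5 + 2 * (l + 1) = 3 + (4 + 2 * l) := by ring
    have a4 : ∑ j ∈ Finset.range (l + 1), (3 + 2 * (j : ℂ)) /
          (z iB ^ (5 + 2 * j) * z i1 ^ (2 + 2 * (l + 1) - 2 * j))
        = ∑ j ∈ Finset.range (l + 1), (3 + 2 * (j : ℂ)) /
          (z i1 ^ (4 + 2 * l - 2 * j) * z iB ^ (5 + 2 * j)) := by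
      refine Finset.sum_congr rfl fun j _ => ?_
      have : 2 + 2 * (l + 1) - 2 * j = 4 + 2 * l - 2 * j := by omega
      rw [this, mul_comm (z iB ^ (5 + 2 * j))]
    have a5 : ∑ k ∈ Finset.range (l + 1),
            (3 + 2 * (l : ℂ)) * (3 + 2 * (k : ℂ)) /
              ((z i1) ^ (4 + 2 * l - 2 * k) * (z iB) ^ (5 + 2 * k)) * pdC (fun σ => F σ z) l ρ
        = (3 + 2 * (l : ℂ)) * (∑ j ∈ Finset.range (l + 1), (3 + 2 * (j : ℂ)) /
          (z i1 ^ (4 + 2 * l - 2 * j) * z iB ^ (5 + 2 * j))) * pdC (fun σ => F σ z) l ρ := by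
      rw [Finset.mul_sum, Finset.sum_mul]
      refine Finset.sum_congr rfl fun j _ => ?_
      ring
    rw [a5, a4, a1, a2, a3, pow_add (z i1) 2 (4 + 2 * l), pow_add (z iB) 3 (4 + 2 * l)]
    simp only [Nat.mul_zero, add_zero, zero_add, Finset.sum_range_one, Nat.cast_zero, mul_zero,
      Nat.sub_zero]
    push_cast
    simp only [div_eq_mul_inv, mul_inv]
    field_simp
    ring
  · rw [← Finset.sum_neg_distrib]
    refine Finset.sum_congr rfl fun i hi => ?_
    have hzi := hzI i hi
    simp only [Nat.mul_zero, add_zero, zero_add, Finset.sum_range_one, Nat.cast_zero, mul_zero,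
      Nat.sub_zero]
    simp only [div_eq_mul_inv, mul_inv]
    field_simp
    ring
end
end
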